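/- (Necessary condition at an interior positive maximum.) There exist positive constants C₁, C₂, C depending only on n, λ, Λ, μ, β with the following property. Let u be a viscosity solution of F(x,u,Du,D²u)=0 in Ω, let Q ⊂ Ω × Ω be a bounded domain, and let Φ ∈ C²(Q) be nonnegative. Suppose u(x) − u(y) − Φ(x,y) attains a positive maximum over Q at an interior point (x̄,ȳ) ∈ Q (so in particular x̄ ≠ ȳ). Then at (x̄,ȳ), with Z₁ = (∂_x+∂_y)²Φ, Z₂ = (∂_x−∂_y)²Φ, Z = (∂_x−∂_y)(∂_x+∂_y)Φ, Z₀ = (∂_x+∂_y)Φ, A = |Z₀| + |(∂_x−∂_y)Φ|, ω = C₂[(1+A)|x̄−ȳ| + |Z₀|/(1+Λ)]^β, and Υ = (x̄−ȳ)⊗(x̄−ȳ)/|x̄−ȳ|², the following inequality holds: −(λ/2 − 2C₁ω)·Tr(Υ Z₂) ≤ C[‖Z₁‖ + (1 + A² + ‖Z‖)ω + ‖Z₂‖ω²]. -/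

import Mathlib

open Metric Set
open scoped RealInnerProductSpace

noncomputable def opNorm {n : ℕ} (M : Matrix (Fin n) (Fin n) ℝ) : ℝ :=
  ‖Matrix.toEuclideanCLM (𝕜 := ℝ) M‖

noncomputable def gradVec {n : ℕ} (φ : EuclideanSpace ℝ (Fin n) → ℝ)
    (x : EuclideanSpace ℝ (Fin n)) : EuclideanSpace ℝ (Fin n) :=
  (WithLp.equiv 2 (Fin n → ℝ)).symm fun i => fderiv ℝ φ x (EuclideanSpace.single i 1)

noncomputable def hessMat {n : ℕ} (φ : EuclideanSpace ℝ (Fin n) → ℝ)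
    (x : EuclideanSpace ℝ (Fin n)) : Matrix (Fin n) (Fin n) ℝ :=
  Matrix.of fun i j =>
    iteratedFDeriv ℝ 2 φ x ![EuclideanSpace.single i 1, EuclideanSpace.single j 1]

def IsViscositySubsolution {n : ℕ} (Ω : Set (EuclideanSpace ℝ (Fin n)))
    (F : EuclideanSpace ℝ (Fin n) → ℝ → EuclideanSpace ℝ (Fin n) →
      Matrix (Fin n) (Fin n) ℝ → ℝ)
    (u : EuclideanSpace ℝ (Fin n) → ℝ) : Prop :=
  UpperSemicontinuousOn u Ω ∧
    ∀ φ : EuclideanSpace ℝ (Fin n) → ℝ, ContDiff ℝ 2 φ →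
      ∀ x₀ ∈ Ω, IsLocalMaxOn (fun x => u x - φ x) Ω x₀ →
        F x₀ (u x₀) (gradVec φ x₀) (hessMat φ x₀) ≤ 0

def IsViscositySupersolution {n : ℕ} (Ω : Set (EuclideanSpace ℝ (Fin n)))
    (F : EuclideanSpace ℝ (Fin n) → ℝ → EuclideanSpace ℝ (Fin n) →
      Matrix (Fin n) (Fin n) ℝ → ℝ)
    (u : EuclideanSpace ℝ (Fin n) → ℝ) : Prop :=
  LowerSemicontinuousOn u Ω ∧
    ∀ φ : EuclideanSpace ℝ (Fin n) → ℝ, ContDiff ℝ 2 φ →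
      ∀ x₀ ∈ Ω, IsLocalMinOn (fun x => u x - φ x) Ω x₀ →
        0 ≤ F x₀ (u x₀) (gradVec φ x₀) (hessMat φ x₀)

def IsViscositySolution {n : ℕ} (Ω : Set (EuclideanSpace ℝ (Fin n)))
    (F : EuclideanSpace ℝ (Fin n) → ℝ → EuclideanSpace ℝ (Fin n) →
      Matrix (Fin n) (Fin n) ℝ → ℝ)
    (u : EuclideanSpace ℝ (Fin n) → ℝ) : Prop :=
  IsViscositySubsolution Ω F u ∧ IsViscositySupersolution Ω F u

def UniformlyElliptic {n : ℕ} (lam Lam : ℝ)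
    (F : EuclideanSpace ℝ (Fin n) → ℝ → EuclideanSpace ℝ (Fin n) →
      Matrix (Fin n) (Fin n) ℝ → ℝ) : Prop :=
  ∀ x z p (X Y : Matrix (Fin n) (Fin n) ℝ), X.IsSymm → Y.IsSymm →
    (X - Y).PosSemidef →
      lam * (X - Y).trace ≤ F x z p Y - F x z p X ∧
        F x z p Y - F x z p X ≤ Lam * (X - Y).trace

def MonotoneInZ {n : ℕ}
    (F : EuclideanSpace ℝ (Fin n) → ℝ → EuclideanSpace ℝ (Fin n) →
      Matrix (Fin n) (Fin n) ℝ → ℝ) : Prop :=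
  ∀ x z w p X, z ≤ w → F x z p X ≤ F x w p X

def NaturalStructureCondition {n : ℕ} (mu beta : ℝ)
    (F : EuclideanSpace ℝ (Fin n) → ℝ → EuclideanSpace ℝ (Fin n) →
      Matrix (Fin n) (Fin n) ℝ → ℝ) : Prop :=
  ∀ x y z w p q (X : Matrix (Fin n) (Fin n) ℝ), X.IsSymm →
    |F x z p X - F y w q X| ≤
      mu * (‖x - y‖ * (1 + ‖p‖ + ‖q‖) + ‖p - q‖ / (1 + ‖p‖ + ‖q‖)) ^ beta *
        (1 + ‖p‖ ^ 2 + ‖q‖ ^ 2 + opNorm X)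

noncomputable def basisE {n : ℕ} (i : Fin n) : EuclideanSpace ℝ (Fin n) :=
  EuclideanSpace.single i 1

/-- The vector `Z₀ = (∂_x + ∂_y)Φ` at a point of `Q`. -/
noncomputable def Z0vec {n : ℕ}
    (Q : Set (EuclideanSpace ℝ (Fin n) × EuclideanSpace ℝ (Fin n)))
    (Φ : EuclideanSpace ℝ (Fin n) × EuclideanSpace ℝ (Fin n) → ℝ)
    (p : EuclideanSpace ℝ (Fin n) × EuclideanSpace ℝ (Fin n)) :
    EuclideanSpace ℝ (Fin n) :=
  (WithLp.equiv 2 (Fin n → ℝ)).symm fun i =>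
    fderivWithin ℝ Φ Q p (basisE i, basisE i)

/-- The vector `(∂_x − ∂_y)Φ` at a point of `Q`. -/
noncomputable def Wvec {n : ℕ}
    (Q : Set (EuclideanSpace ℝ (Fin n) × EuclideanSpace ℝ (Fin n)))
    (Φ : EuclideanSpace ℝ (Fin n) × EuclideanSpace ℝ (Fin n) → ℝ)
    (p : EuclideanSpace ℝ (Fin n) × EuclideanSpace ℝ (Fin n)) :
    EuclideanSpace ℝ (Fin n) :=
  (WithLp.equiv 2 (Fin n → ℝ)).symm fun i =>
    fderivWithin ℝ Φ Q p (basisE i, -basisE i)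

/-- The matrix `Z₁ = (∂_x + ∂_y)²Φ` at a point of `Q`. -/
noncomputable def Z1mat {n : ℕ}
    (Q : Set (EuclideanSpace ℝ (Fin n) × EuclideanSpace ℝ (Fin n)))
    (Φ : EuclideanSpace ℝ (Fin n) × EuclideanSpace ℝ (Fin n) → ℝ)
    (p : EuclideanSpace ℝ (Fin n) × EuclideanSpace ℝ (Fin n)) :
    Matrix (Fin n) (Fin n) ℝ :=
  Matrix.of fun i j =>
    iteratedFDerivWithin ℝ 2 Φ Q p ![(basisE i, basisE i), (basisE j, basisE j)]

/-- The matrix `Z₂ = (∂_x − ∂_y)²Φ` at a point of `Q`. -/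
noncomputable def Z2mat {n : ℕ}
    (Q : Set (EuclideanSpace ℝ (Fin n) × EuclideanSpace ℝ (Fin n)))
    (Φ : EuclideanSpace ℝ (Fin n) × EuclideanSpace ℝ (Fin n) → ℝ)
    (p : EuclideanSpace ℝ (Fin n) × EuclideanSpace ℝ (Fin n)) :
    Matrix (Fin n) (Fin n) ℝ :=
  Matrix.of fun i j =>
    iteratedFDerivWithin ℝ 2 Φ Q p ![(basisE i, -basisE i), (basisE j, -basisE j)]

/-- The matrix `Z = (∂_x − ∂_y)(∂_x + ∂_y)Φ` at a point of `Q`. -/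
noncomputable def Zmat {n : ℕ}
    (Q : Set (EuclideanSpace ℝ (Fin n) × EuclideanSpace ℝ (Fin n)))
    (Φ : EuclideanSpace ℝ (Fin n) × EuclideanSpace ℝ (Fin n) → ℝ)
    (p : EuclideanSpace ℝ (Fin n) × EuclideanSpace ℝ (Fin n)) :
    Matrix (Fin n) (Fin n) ℝ :=
  Matrix.of fun i j =>
    iteratedFDerivWithin ℝ 2 Φ Q p ![(basisE i, -basisE i), (basisE j, basisE j)]

/-- `A = |Z₀| + |(∂_x − ∂_y)Φ|`. -/
noncomputable def Aconst {n : ℕ}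
    (Q : Set (EuclideanSpace ℝ (Fin n) × EuclideanSpace ℝ (Fin n)))
    (Φ : EuclideanSpace ℝ (Fin n) × EuclideanSpace ℝ (Fin n) → ℝ)
    (p : EuclideanSpace ℝ (Fin n) × EuclideanSpace ℝ (Fin n)) : ℝ :=
  ‖Z0vec Q Φ p‖ + ‖Wvec Q Φ p‖

/-- `ω = C₂ [(1+A)|x−y| + |Z₀|/(1+Λ)]^β`. -/
noncomputable def omegaConst {n : ℕ} (C₂ Lam beta : ℝ)
    (Q : Set (EuclideanSpace ℝ (Fin n) × EuclideanSpace ℝ (Fin n)))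
    (Φ : EuclideanSpace ℝ (Fin n) × EuclideanSpace ℝ (Fin n) → ℝ)
    (p : EuclideanSpace ℝ (Fin n) × EuclideanSpace ℝ (Fin n)) : ℝ :=
  C₂ * ((1 + Aconst Q Φ p) * ‖p.1 - p.2‖ + ‖Z0vec Q Φ p‖ / (1 + Lam)) ^ beta

/-- The rank-one matrix `Υ = (x−y)⊗(x−y)/|x−y|²`. -/
noncomputable def UpsMat {n : ℕ}
    (p : EuclideanSpace ℝ (Fin n) × EuclideanSpace ℝ (Fin n)) :
    Matrix (Fin n) (Fin n) ℝ :=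
  Matrix.of fun i j => (p.1 i - p.2 i) * (p.1 j - p.2 j) / ‖p.1 - p.2‖ ^ 2

section

open Filter Topology MeasureTheory Module

section SecondOrder

variable {V : Type*} [NormedAddCommGroup V] [NormedSpace ℝ V]

/-- A function whose derivative is itself differentiable at `x` has a second order Taylor
expansion at `x`. -/
lemma second_order_expansion {g : V → ℝ} {J : V → V →L[ℝ] ℝ} {J' : V →L[ℝ] V →L[ℝ] ℝ} {x : V}
    (hg : ∀ᶠ y in 𝓝 x, HasFDerivAt g (J y) y) (hJ : HasFDerivAt J J' x) {σ : ℝ} (hσ : 0 < σ) :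
    ∀ᶠ v in 𝓝 (0 : V), |g (x + v) - g x - J x v - J' v v / 2| ≤ σ * ‖v‖ ^ 2 := by
  have h1 := hJ.isLittleO.def hσ
  obtain ⟨r, hr, hball⟩ := Metric.eventually_nhds_iff.1 (hg.and h1)
  refine Metric.eventually_nhds_iff.2 ⟨r, hr, fun v hv => ?_⟩
  rw [dist_zero_right] at hv
  have hseg : ∀ t ∈ Icc (0 : ℝ) 1, dist (x + t • v) x < r := fun t ht => by
    rw [dist_eq_norm, add_sub_cancel_left, norm_smul, Real.norm_of_nonneg ht.1]
    nlinarith [ht.1, ht.2, norm_nonneg v]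
  have hd : ∀ t ∈ Icc (0 : ℝ) 1,
      HasDerivWithinAt (fun t : ℝ => g (x + t • v) - t * J x v - t ^ 2 * (J' v v / 2))
        (J (x + t • v) v - J x v - t * J' v v) (Icc 0 1) t := fun t ht => by
    have hline : HasDerivAt (fun t : ℝ => x + t • v) v t := by
      simpa using ((hasDerivAt_id t).smul_const v).const_add x
    have h2 := (hball (hseg t ht)).1.comp_hasDerivAt t hline
    have h3 := (h2.sub ((hasDerivAt_id t).mul_const (J x v))).sub
      (((hasDerivAt_id t).pow 2).mul_const (J' v v / 2))
    refine HasDerivAt.hasDerivWithinAt (h3.congr_deriv ?_)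
    simp
    ring
  have hb : ∀ t ∈ Ico (0 : ℝ) 1, ‖J (x + t • v) v - J x v - t * J' v v‖ ≤ σ * ‖v‖ ^ 2 :=
    fun t ht => by
    have h4 := (hball (hseg t (Ico_subset_Icc_self ht))).2
    rw [add_sub_cancel_left, norm_smul, Real.norm_of_nonneg ht.1] at h4
    have h5 := (J (x + t • v) - J x - J' (t • v)).le_of_opNorm_le h4 v
    have h6 : (J (x + t • v) - J x - J' (t • v)) v = J (x + t • v) v - J x v - t * J' v v := by
      simp
    rw [h6] at h5
    refine h5.trans ?_
    have : t * ‖v‖ ≤ ‖v‖ := mul_le_of_le_one_left (norm_nonneg v) ht.2.le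
    calc σ * (t * ‖v‖) * ‖v‖ ≤ σ * ‖v‖ * ‖v‖ := by gcongr
      _ = _ := by ring
  have h7 := norm_image_sub_le_of_norm_deriv_le_segment_01' hd hb
  rw [Real.norm_eq_abs] at h7
  convert h7 using 2
  simp
  ring

/-- If `w` lies in every neighbourhood after scaling, a local quadratic inequality up to an
arbitrarily small error is a global one. -/
lemma quadratic_le_of_eventually_le {a b : V →L[ℝ] V →L[ℝ] ℝ}
    (h : ∀ σ > 0, ∀ᶠ v in 𝓝 (0 : V), a v v ≤ b v v + σ * ‖v‖ ^ 2) (v : V) : a v v ≤ b v v := by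
  have key : ∀ σ > 0, a v v ≤ b v v + σ * ‖v‖ ^ 2 := fun σ hσ => by
    have hlim : Tendsto (fun t : ℝ => t • v) (𝓝[>] 0) (𝓝 0) := by
      have : Tendsto (fun t : ℝ => t • v) (𝓝 0) (𝓝 ((0 : ℝ) • v)) :=
        (continuous_id.smul continuous_const).tendsto 0
      rw [zero_smul] at this
      exact this.mono_left nhdsWithin_le_nhds
    obtain ⟨t, ht, ht0⟩ := ((hlim.eventually (h σ hσ)).and self_mem_nhdsWithin).exists
    have ht0 : 0 < t := ht0
    simp only [map_smul, smul_apply, smul_eq_mul, norm_smul,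
      Real.norm_of_nonneg ht0.le] at ht
    have : t ^ 2 * a v v ≤ t ^ 2 * (b v v + σ * ‖v‖ ^ 2) := by nlinarith
    exact le_of_mul_le_mul_left this (by positivity)
  refine le_of_forall_pos_le_add fun e he => ?_
  have h1 := key (e / (‖v‖ ^ 2 + 1)) (by positivity)
  have h2 : e / (‖v‖ ^ 2 + 1) * ‖v‖ ^ 2 ≤ e := by
    rw [div_mul_eq_mul_div, div_le_iff₀ (by positivity)]
    nlinarith
  linarith

variable [FiniteDimensional ℝ V]

/-- Jensen's lemma for functions with Lipschitz gradient: near a strict minimum of `g - B/2` there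
are points of twice differentiability of `g` at which the gradient is small and the Hessian is
bounded below by `B`. -/
lemma exists_twice_differentiable_near_strict_min {g : V → ℝ} {J : V → V →L[ℝ] ℝ}
    {C : NNReal} (hg : ∀ x, HasFDerivAt g (J x) x) (hJ : LipschitzWith C J)
    {B : V →L[ℝ] V →L[ℝ] ℝ} (hB : ∀ x y, B x y = B y x) {ε : ℝ} (hε : 0 < ε) (hg0 : g 0 ≤ 0)
    (hlow : ∀ x, B x x / 2 + ε * ‖x‖ ^ 2 ≤ g x) {ρ : ℝ} (hρ : 0 < ρ) :
    ∃ (x : V) (J' : V →L[ℝ] V →L[ℝ] ℝ), ‖x‖ < ρ ∧ ‖J x‖ < ρ ∧ HasFDerivAt J J' x ∧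
      ∀ v, B v v ≤ J' v v := by
  let _ : MeasurableSpace V := borel V
  have _ : BorelSpace V := ⟨rfl⟩
  let _ : MeasurableSpace (V →L[ℝ] ℝ) := borel _
  have _ : BorelSpace (V →L[ℝ] ℝ) := ⟨rfl⟩
  have hdim : finrank ℝ (V →L[ℝ] ℝ) = finrank ℝ V := by
    rw [← (LinearMap.toContinuousLinearMap : (V →ₗ[ℝ] ℝ) ≃ₗ[ℝ] _).finrank_eq]
    exact Subspace.dual_finrank_eq
  set G : V → V →L[ℝ] ℝ := fun x => J x - B x with hG
  have hGL : LipschitzWith (C + ‖B‖₊) G := hJ.sub B.lipschitz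
  set N : Set V := {x | ¬ DifferentiableAt ℝ J x} with hN
  have hN0 : μH[finrank ℝ V] N = 0 := hJ.ae_differentiableAt (μ := μH[finrank ℝ V])
  have hGN : μH[finrank ℝ (V →L[ℝ] ℝ)] (G '' N) = 0 := by
    rw [hdim]
    refine le_antisymm ((hGL.hausdorffMeasure_image_le (Nat.cast_nonneg _) N).trans ?_) zero_le
    rw [hN0, mul_zero]
  set r : ℝ := ρ / (1 + ε + ‖B‖) with hr
  have hr0 : 0 < r := by positivity
  have hrρ : r * (1 + ε + ‖B‖) = ρ := by rw [hr]; field_simp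
  obtain ⟨p, hp, hpN⟩ : ∃ p ∈ ball (0 : V →L[ℝ] ℝ) (ε * r), p ∉ G '' N := by
    by_contra! hcon
    have h1 : 0 < μH[finrank ℝ (V →L[ℝ] ℝ)] (ball (0 : V →L[ℝ] ℝ) (ε * r)) :=
      measure_ball_pos _ _ (by positivity)
    exact h1.ne' (measure_mono_null hcon hGN)
  rw [mem_ball_zero_iff] at hp
  set q : V → ℝ := fun x => g x - B x x / 2 - p x with hq
  have hqd : ∀ x, HasFDerivAt q (G x - p) x := fun x => by
    have h1 : HasFDerivAt (fun x => B x x) (B x + B.flip x) x := by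
      have := B.isBoundedBilinearMap.hasFDerivAt (x, x)
      have h2 := HasFDerivAt.comp (g := fun p : V × V => B p.1 p.2) (f := fun x => (x, x)) x this
        ((hasFDerivAt_id x).prodMk (hasFDerivAt_id x))
      refine h2.congr_fderiv ?_
      ext v
      simp [IsBoundedBilinearMap.deriv]
    have h2 := ((hg x).sub (h1.const_mul (1 / 2))).sub p.hasFDerivAt
    refine (h2.congr_fderiv ?_).congr_of_eventuallyEq (.of_forall fun y => ?_)
    · ext v
      simp [hG, hB v x]
      ring
    · simp [hq]
      ring
  have hqc : Continuous q := continuous_iff_continuousAt.2 fun x => (hqd x).continuousAt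
  obtain ⟨m, hm, hmin⟩ := (isCompact_closedBall (0 : V) r).exists_isMinOn
    ⟨0, mem_closedBall_self hr0.le⟩ hqc.continuousOn
  have hmr : ‖m‖ < r := by
    have h1 : q m ≤ q 0 := hmin (mem_closedBall_self hr0.le)
    have h2 : q 0 ≤ 0 := by simpa [hq] using hg0
    have h3 := hlow m
    have h4 : p m ≤ ‖p‖ * ‖m‖ := (le_abs_self _).trans (p.le_opNorm m)
    have h5 : ε * ‖m‖ ^ 2 ≤ ‖p‖ * ‖m‖ := by
      have h6 : g m - B m m / 2 - p m ≤ 0 := h1.trans h2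
      linarith
    by_contra! hcon
    have hm0 : 0 < ‖m‖ := hr0.trans_le hcon
    have h7 := mul_lt_mul_of_pos_right hp hm0
    have h8 := mul_le_mul_of_nonneg_left hcon (mul_pos hε hm0).le
    nlinarith
  have hloc : IsLocalMin q m :=
    hmin.isLocalMin (closedBall_mem_nhds_of_mem (by simpa using hmr))
  have hGm : G m = p := sub_eq_zero.1 (hloc.hasFDerivAt_eq_zero (hqd m))
  have hdiff : DifferentiableAt ℝ J m := by
    by_contra hcon
    exact hpN ⟨m, hcon, hGm⟩
  have hJm : J m = p + B m := by rw [← hGm]; simp [hG]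
  refine ⟨m, fderiv ℝ J m, ?_, ?_, hdiff.hasFDerivAt, ?_⟩
  · nlinarith [norm_nonneg B]
  · rw [hJm]
    have := B.le_opNorm m
    have := norm_add_le p (B m)
    nlinarith [norm_nonneg B]
  · refine quadratic_le_of_eventually_le fun σ hσ => ?_
    have htay := second_order_expansion (.of_forall hg) hdiff.hasFDerivAt (half_pos hσ)
    have hloc' : ∀ᶠ v in 𝓝 (0 : V), q m ≤ q (m + v) := by
      have : Tendsto (fun v => m + v) (𝓝 0) (𝓝 m) := by
        simpa using (continuous_const_add m).tendsto (0 : V)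
      exact this.eventually hloc
    filter_upwards [htay, hloc'] with v h1 h2
    have h3 := (abs_le.1 h1).2
    simp only [hq, map_add, add_apply] at h2
    rw [hJm] at h3
    simp only [add_apply] at h3
    linarith [hB v m]

end SecondOrder

section Regularization

variable {E : Type*} [NormedAddCommGroup E] [InnerProductSpace ℝ E]

/-- First order optimality for the maximum of a linear form minus a convex function minus
a multiple of the squared norm. -/
lemma subgradient_of_isMax {f : E → ℝ} (hf : ConvexOn ℝ univ f) {δ : ℝ} (hδ : 0 < δ) {η s : E}
    (hs : ∀ s', ⟪s', η⟫ - δ / 2 * ‖s'‖ ^ 2 - f s' ≤ ⟪s, η⟫ - δ / 2 * ‖s‖ ^ 2 - f s) (d : E) :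
    f s + ⟪d, η - δ • s⟫ ≤ f (s + d) := by
  refine le_of_forall_pos_le_add fun e he => ?_
  set c : ℝ := δ / 2 * ‖d‖ ^ 2 with hc
  have hc0 : 0 ≤ c := by positivity
  set t : ℝ := e / (e + c) with ht
  have ht0 : 0 < t := by positivity
  have ht1 : t ≤ 1 := by rw [ht, div_le_one (by positivity)]; linarith
  have htc : t * c ≤ e := by
    rw [ht, div_mul_eq_mul_div, div_le_iff₀ (by positivity)]
    nlinarith
  have h1 := hs (s + t • d)
  have h2 := hf.2 (mem_univ s) (mem_univ (s + d)) (sub_nonneg.2 ht1) ht0.le (by ring)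
  have h3 : (1 - t) • s + t • (s + d) = s + t • d := by module
  rw [h3, smul_eq_mul, smul_eq_mul] at h2
  rw [norm_add_sq_real, inner_add_left, real_inner_smul_left, real_inner_smul_right, norm_smul,
    Real.norm_of_nonneg ht0.le] at h1
  rw [inner_sub_right, real_inner_smul_right, real_inner_comm s d]
  have h4 : t * (⟪d, η⟫ - δ * ⟪s, d⟫) ≤ t * (f (s + d) - f s + t * c) := by
    rw [hc]
    nlinarith
  have h5 := le_of_mul_le_mul_left h4 ht0
  linarith

variable [FiniteDimensional ℝ E]

/-- The Legendre transform of a function continuous on a ball, with attained suprema. -/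
lemma exists_legendre_transform {H : E → ℝ} {r : ℝ} (hr : 0 ≤ r)
    (hH : ContinuousOn H (closedBall 0 r)) :
    ∃ (f : E → ℝ) (ξ : E → E), (∀ s, ξ s ∈ closedBall (0 : E) r) ∧
      (∀ s, f s = ⟪s, ξ s⟫ - H (ξ s)) ∧ ∀ s, ∀ x ∈ closedBall (0 : E) r, ⟪s, x⟫ - H x ≤ f s := by
  have h : ∀ s : E, ∃ x ∈ closedBall (0 : E) r,
      IsMaxOn (fun x => ⟪s, x⟫ - H x) (closedBall 0 r) x :=
    fun s => (isCompact_closedBall (0 : E) r).exists_isMaxOn ⟨0, mem_closedBall_self hr⟩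
      ((continuous_const.inner continuous_id).continuousOn.sub hH)
  choose ξ hξ hmax using h
  exact ⟨fun s => ⟪s, ξ s⟫ - H (ξ s), ξ, hξ, fun _ => rfl, fun s x hx => hmax s hx⟩

/-- A strongly concave perturbation of a linear form minus a Lipschitz function attains its
maximum. -/
lemma exists_isMax_inner_sub {f : E → ℝ} {r δ : ℝ} (hδ : 0 < δ) (hr : 0 ≤ r)
    (hf : ∀ s s', f s' ≤ f s + r * ‖s' - s‖) (η : E) :
    ∃ s, ∀ s', ⟪s', η⟫ - δ / 2 * ‖s'‖ ^ 2 - f s' ≤ ⟪s, η⟫ - δ / 2 * ‖s‖ ^ 2 - f s := by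
  have hfc : Continuous f := by
    refine LipschitzWith.continuous (K := ⟨r, hr⟩) (LipschitzWith.of_le_add_mul _ fun s s' => ?_)
    rw [dist_eq_norm]
    exact hf s' s
  have hc : Continuous fun s : E => ⟪s, η⟫ - δ / 2 * ‖s‖ ^ 2 - f s := by fun_prop
  set R : ℝ := 2 * (‖η‖ + r) / δ with hR
  have hR0 : 0 ≤ R := by positivity
  obtain ⟨s, -, hs⟩ := (isCompact_closedBall (0 : E) R).exists_isMaxOn
    ⟨0, mem_closedBall_self hR0⟩ hc.continuousOn
  refine ⟨s, fun s' => ?_⟩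
  by_cases hs' : ‖s'‖ ≤ R
  · exact hs (mem_closedBall_zero_iff.2 hs')
  · refine le_trans ?_ (hs (mem_closedBall_self hR0))
    have h1 := hf s' 0
    have h2 := real_inner_le_norm s' η
    have h3 : 2 * (‖η‖ + r) ≤ δ * ‖s'‖ := by
      rw [not_le, hR, div_lt_iff₀ hδ] at hs'
      linarith
    have h4 := mul_le_mul_of_nonneg_right h3 (norm_nonneg s')
    simp only [zero_sub, norm_neg, inner_zero_left, norm_zero] at h1 ⊢
    nlinarith

/-- Regularization of `H` on a ball: the Moreau envelope of its convex envelope. It is `C^{1,1}`,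
and wherever it has strictly positive second order growth it touches an inf-convolution of `H`. -/
lemma exists_smooth_minorant {H : E → ℝ} {r : ℝ} (hr : 0 ≤ r)
    (hH : ContinuousOn H (closedBall 0 r)) (hH0 : H 0 ≤ 0) {δ : ℝ} (hδ : 0 < δ) :
    ∃ (k : E → ℝ) (J : E → E), LipschitzWith (Real.toNNReal δ⁻¹) J ∧
      (∀ η, HasFDerivAt k (innerSL ℝ (J η)) η) ∧ k 0 ≤ 0 ∧
      (∀ η s, ∃ ξ ∈ closedBall (0 : E) r,
        ⟪s, η⟫ - δ / 2 * ‖s‖ ^ 2 - (⟪s, ξ⟫ - H ξ) ≤ k η) ∧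
      ∀ η, ∀ c > 0, (∀ᶠ v in 𝓝 (0 : E), k η + ⟪J η, v⟫ + c * ‖v‖ ^ 2 ≤ k (η + v)) →
        η - δ • J η ∈ closedBall (0 : E) r ∧ ∀ ξ ∈ closedBall (0 : E) r,
          H (η - δ • J η) + (k (ξ + δ • J η) - k η) ≤ H ξ := by
  obtain ⟨f, ξf, hξf, hfeq, hf⟩ := exists_legendre_transform hr hH
  have hsub : ∀ s d, f s + ⟪d, ξf s⟫ ≤ f (s + d) := fun s d => by
    have := hf (s + d) (ξf s) (hξf s)
    rw [inner_add_left] at this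
    linarith [hfeq s]
  have hfl : ∀ s s', f s' ≤ f s + r * ‖s' - s‖ := fun s s' => by
    have h1 := hsub s' (s - s')
    rw [add_sub_cancel] at h1
    have h2 := (abs_le.1 (abs_real_inner_le_norm (s - s') (ξf s'))).1
    have h3 := mem_closedBall_zero_iff.1 (hξf s')
    rw [norm_sub_rev] at h2
    nlinarith [norm_nonneg (s' - s)]
  have hf0 : ∀ s, 0 ≤ f s := fun s => by
    have := hf s 0 (mem_closedBall_self hr)
    rw [inner_zero_right] at this
    linarith
  have hconv : ConvexOn ℝ univ f := by
    refine ⟨convex_univ, fun x _ y _ a b ha hb hab => ?_⟩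
    have h1 := hf x _ (hξf (a • x + b • y))
    have h2 := hf y _ (hξf (a • x + b • y))
    rw [hfeq (a • x + b • y), inner_add_left, real_inner_smul_left, real_inner_smul_left]
    simp only [smul_eq_mul]
    obtain rfl : b = 1 - a := by linarith
    linarith [mul_le_mul_of_nonneg_left h1 ha, mul_le_mul_of_nonneg_left h2 hb]
  choose J hJ using exists_isMax_inner_sub hδ hr hfl
  set k : E → ℝ := fun η => ⟪J η, η⟫ - δ / 2 * ‖J η‖ ^ 2 - f (J η) with hk
  have hkJ : ∀ η s, ⟪s, η⟫ - δ / 2 * ‖s‖ ^ 2 - f s ≤ k η := fun η s => hJ η s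
  have hkadd : ∀ η v, k η + ⟪J η, v⟫ ≤ k (η + v) := fun η v => by
    have := hkJ (η + v) (J η)
    rw [inner_add_right] at this
    simp only [hk] at this ⊢
    linarith
  have hJsub := fun η => subgradient_of_isMax hconv hδ (hJ η)
  have hJL : ∀ η η', δ * ‖J η' - J η‖ ≤ ‖η' - η‖ := fun η η' => by
    have h1 := hJsub η (J η' - J η)
    have h2 := hJsub η' (J η - J η')
    rw [add_sub_cancel] at h1 h2
    have h3 : ⟪J η - J η', η' - δ • J η'⟫ = -⟪J η' - J η, η' - δ • J η'⟫ := by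
      rw [← inner_neg_left, neg_sub]
    have h4 : ⟪J η' - J η, η - δ • J η⟫ - ⟪J η' - J η, η' - δ • J η'⟫ =
        δ * ‖J η' - J η‖ ^ 2 - ⟪J η' - J η, η' - η⟫ := by
      rw [← inner_sub_right, ← real_inner_self_eq_norm_sq, ← real_inner_smul_right,
        ← inner_sub_right]
      congr 1
      module
    have h5 := real_inner_le_norm (J η' - J η) (η' - η)
    have h6 : ‖J η' - J η‖ * (δ * ‖J η' - J η‖) ≤ ‖J η' - J η‖ * ‖η' - η‖ := by nlinarith
    rcases (norm_nonneg (J η' - J η)).eq_or_lt with h | h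
    · rw [← h, mul_zero]
      exact norm_nonneg _
    · exact le_of_mul_le_mul_left h6 h
  refine ⟨k, J, ?_, ?_, ?_, ?_, ?_⟩
  · refine LipschitzWith.of_dist_le_mul fun η' η => ?_
    rw [dist_eq_norm, dist_eq_norm, Real.coe_toNNReal _ (by positivity), inv_mul_eq_div,
      le_div_iff₀ hδ]
    linarith [hJL η η']
  · intro η
    rw [hasFDerivAt_iff_isLittleO_nhds_zero, Asymptotics.isLittleO_iff]
    intro c hc
    refine Metric.eventually_nhds_iff.2 ⟨c * δ, by positivity, fun v hv => ?_⟩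
    rw [dist_zero_right] at hv
    have h1 := hkadd η v
    have h2 := hkadd (η + v) (-v)
    rw [add_neg_cancel_right, inner_neg_right] at h2
    have h3 := real_inner_le_norm (J (η + v) - J η) v
    rw [inner_sub_left] at h3
    have h4 := hJL η (η + v)
    rw [add_sub_cancel_left] at h4
    have h5 : ‖J (η + v) - J η‖ ≤ c := le_of_mul_le_mul_left (by linarith) hδ
    rw [innerSL_apply_apply, Real.norm_eq_abs, abs_of_nonneg (by linarith)]
    nlinarith [norm_nonneg v]
  · have := hf0 (J 0)
    simp only [hk, inner_zero_right]
    nlinarith [sq_nonneg ‖J 0‖]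
  · intro η s
    refine ⟨ξf s, hξf s, ?_⟩
    rw [← hfeq]
    exact hkJ η s
  · intro η c hc hgrow
    set s := J η with hs
    set d := ξf s + δ • s - η with hd
    have h1 : k (η + d) ≤ k η + ⟪s, d⟫ := by
      have h2 := hsub s (J (η + d) - s)
      rw [add_sub_cancel s] at h2
      have h3 : ⟪J (η + d) - s, η + d⟫ = ⟪J (η + d) - s, ξf s⟫ + δ * ⟪J (η + d) - s, s⟫ := by
        rw [hd, add_sub_cancel, inner_add_right, real_inner_smul_right]
      have h4 := norm_add_sq_real (J (η + d) - s) s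
      rw [sub_add_cancel] at h4
      have h5 : ⟪J (η + d), η + d⟫ = ⟪J (η + d) - s, η + d⟫ + ⟪s, η⟫ + ⟪s, d⟫ := by
        rw [inner_sub_left, inner_add_right s]; ring
      simp only [hk]
      rw [← hs]
      nlinarith [sq_nonneg ‖J (η + d) - s‖]
    have hd0 : d = 0 := by
      have hlim : Tendsto (fun t : ℝ => t • d) (𝓝[>] 0) (𝓝 0) := by
        have : Tendsto (fun t : ℝ => t • d) (𝓝 0) (𝓝 ((0 : ℝ) • d)) :=
          (continuous_id.smul continuous_const).tendsto 0
        rw [zero_smul] at this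
        exact this.mono_left nhdsWithin_le_nhds
      obtain ⟨t, ht, ht0, ht1⟩ :=
        ((hlim.eventually hgrow).and (Ioo_mem_nhdsGT zero_lt_one)).exists
      have h2 := hkadd (η + t • d) (-(t • d))
      have h3 := hkadd (η + t • d) ((1 - t) • d)
      have h4 : η + t • d + (1 - t) • d = η + d := by module
      rw [add_neg_cancel_right, inner_neg_right, real_inner_smul_right] at h2
      rw [h4, real_inner_smul_right] at h3
      rw [real_inner_smul_right, norm_smul, Real.norm_of_nonneg ht0.le] at ht
      have h5 : k (η + t • d) ≤ k η + t * ⟪s, d⟫ := by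
        nlinarith [mul_le_mul_of_nonneg_left h2 (sub_nonneg.2 ht1.le),
          mul_le_mul_of_nonneg_left h3 ht0.le]
      have h6 : c * (t * ‖d‖) ^ 2 ≤ 0 := by linarith
      have h7 : (t * ‖d‖) ^ 2 ≤ 0 := by
        by_contra! hcon
        exact absurd h6 (not_le.2 (mul_pos hc hcon))
      have h8 : t * ‖d‖ = 0 := pow_eq_zero_iff two_ne_zero |>.1 (le_antisymm h7 (sq_nonneg _))
      exact norm_eq_zero.1 ((mul_eq_zero.1 h8).resolve_left ht0.ne')
    have hξ : η - δ • s = ξf s := by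
      rw [hd, sub_eq_zero] at hd0
      rw [← hd0, add_sub_cancel_right]
    rw [hξ]
    refine ⟨hξf s, fun x hx => ?_⟩
    have hkη : k η = H (ξf s) + δ / 2 * ‖s‖ ^ 2 := by
      have h2 : ⟪s, η⟫ = ⟪s, ξf s⟫ + δ * ‖s‖ ^ 2 := by
        rw [← hξ, inner_sub_right, real_inner_smul_right, real_inner_self_eq_norm_sq]; ring
      simp only [hk]
      rw [← hs, hfeq s, h2]
      ring
    have h2 : k (x + δ • s) ≤ H x + δ / 2 * ‖s‖ ^ 2 := by
      simp only [hk]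
      have h3 := hf (J (x + δ • s)) x hx
      rw [inner_add_right, real_inner_smul_right]
      have h4 := norm_sub_sq_real (J (x + δ • s)) s
      nlinarith [sq_nonneg ‖J (x + δ • s) - s‖]
    linarith

end Regularization

section Sums

variable {E : Type*} [NormedAddCommGroup E] [InnerProductSpace ℝ E]

/-- The real inner product as a continuous bilinear map. -/
noncomputable def innerBilin (E : Type*) [NormedAddCommGroup E] [InnerProductSpace ℝ E] :
    E →L[ℝ] E →L[ℝ] ℝ :=
  (isBoundedBilinearMap_inner (𝕜 := ℝ) (E := E)).toContinuousLinearMap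

@[simp]
lemma innerBilin_apply (a b : E) : innerBilin E a b = ⟪a, b⟫ := rfl

/-- A point of twice differentiability of a regularization yields a second order superjet of the
original function at the translated point. -/
lemma superjet_of_contact {w k : E → ℝ} {J : E → E} {κ δ r σ : ℝ} {η : E}
    {J' : E →L[ℝ] E →L[ℝ] ℝ} (hk : ∀ x, HasFDerivAt k (innerSL ℝ (J x)) x)
    (hcontact : ∀ c > 0, (∀ᶠ v in 𝓝 (0 : E), k η + ⟪J η, v⟫ + c * ‖v‖ ^ 2 ≤ k (η + v)) →
        η - δ • J η ∈ closedBall (0 : E) r ∧ ∀ ξ ∈ closedBall (0 : E) r,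
          κ / 2 * ‖η - δ • J η‖ ^ 2 - w (η - δ • J η) + (k (ξ + δ • J η) - k η) ≤
            κ / 2 * ‖ξ‖ ^ 2 - w ξ)
    (hJ' : HasFDerivAt (fun x => innerSL ℝ (J x)) J' η) (hpos : ∀ v, ‖v‖ ^ 2 / 2 ≤ J' v v)
    (hσ : 0 < σ) (hσ' : σ ≤ 1 / 8) (hr : ‖η - δ • J η‖ < r) :
    ∀ᶠ v in 𝓝 (0 : E), w (η - δ • J η + v) ≤ w (η - δ • J η) +
      ⟪κ • (η - δ • J η) - J η, v⟫ + ((κ + 2 * σ) * ‖v‖ ^ 2 - J' v v) / 2 := by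
  have htay := second_order_expansion (.of_forall hk) hJ' hσ
  simp only [innerSL_apply_apply] at htay
  obtain ⟨-, hc⟩ := hcontact (1 / 8) (by norm_num) (by
    filter_upwards [htay] with v hv
    have h1 := (abs_le.1 hv).1
    nlinarith [hpos v, sq_nonneg ‖v‖])
  set x := η - δ • J η with hx
  have hball : ∀ᶠ v in 𝓝 (0 : E), x + v ∈ closedBall (0 : E) r := by
    have : Tendsto (fun v => x + v) (𝓝 0) (𝓝 x) := by
      simpa using (continuous_const_add x).tendsto (0 : E)
    exact this.eventually (closedBall_mem_nhds_of_mem (by simpa using hr))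
  filter_upwards [htay, hball] with v hv hv'
  have h1 := (abs_le.1 hv).1
  have h2 := hc _ hv'
  have h3 : x + v + δ • J η = η + v := by rw [hx]; module
  rw [h3, norm_add_sq_real] at h2
  rw [inner_sub_left, real_inner_smul_left]
  linarith

variable [FiniteDimensional ℝ E]

set_option maxHeartbeats 1000000 in
set_option maxSynthPendingDepth 3 in
/-- The theorem on sums (Crandall–Ishii lemma) for a quadratic upper bound. -/
lemma theorem_on_sums {w₁ w₂ : E → ℝ} {r : ℝ} (hr : 0 < r)
    (hw₁ : ContinuousOn w₁ (closedBall 0 r)) (hw₂ : ContinuousOn w₂ (closedBall 0 r))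
    (hw₁0 : w₁ 0 = 0) (hw₂0 : w₂ 0 = 0) {N : E × E →L[ℝ] E × E →L[ℝ] ℝ}
    (hN : ∀ a b, N a b = N b a)
    (hle : ∀ x ∈ closedBall (0 : E) r, ∀ y ∈ closedBall (0 : E) r,
      w₁ x + w₂ y ≤ N (x, y) (x, y) / 2) {ε : ℝ} (hε : 0 < ε) :
    ∃ (x y p q : E) (X Y : E →L[ℝ] E →L[ℝ] ℝ), ‖x‖ < ε ∧ ‖y‖ < ε ∧ ‖p‖ < ε ∧ ‖q‖ < ε ∧
      (∀ a b, X a b = X b a) ∧ (∀ a b, Y a b = Y b a) ∧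
      (∀ᶠ v in 𝓝 (0 : E), w₁ (x + v) ≤ w₁ x + ⟪p, v⟫ + X v v / 2) ∧
      (∀ᶠ v in 𝓝 (0 : E), w₂ (y + v) ≤ w₂ y + ⟪q, v⟫ + Y v v / 2) ∧
      ∀ a b, X a a + Y b b ≤ N (a, b) (a, b) + ε * (‖a‖ ^ 2 + ‖b‖ ^ 2) := by
  set ε₀ : ℝ := min ε (min r 1) with hε₀
  have hε₀0 : 0 < ε₀ := lt_min hε (lt_min hr one_pos)
  have hε₀ε : ε₀ ≤ ε := min_le_left _ _
  have hε₀r : ε₀ ≤ r := (min_le_right _ _).trans (min_le_left _ _)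
  have hε₀1 : ε₀ ≤ 1 := (min_le_right _ _).trans (min_le_right _ _)
  set e : ℝ := ε₀ / 4 with he
  have he0 : 0 < e := by positivity
  set κ : ℝ := ‖N‖ + 1 with hκ
  have hκ1 : 1 ≤ κ := by rw [hκ]; linarith [norm_nonneg N]
  set I : E × E →L[ℝ] E × E →L[ℝ] ℝ :=
    (innerBilin E).bilinearComp (.fst ℝ E E) (.fst ℝ E E) +
      (innerBilin E).bilinearComp (.snd ℝ E E) (.snd ℝ E E) with hI
  have hIa : ∀ a b, I a b = ⟪a.1, b.1⟫ + ⟪a.2, b.2⟫ := fun a b => rfl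
  have hIq : ∀ a, I a a = ‖a.1‖ ^ 2 + ‖a.2‖ ^ 2 := fun a => by
    rw [hIa, real_inner_self_eq_norm_sq, real_inner_self_eq_norm_sq]
  have hIn : ∀ a, ‖a‖ ^ 2 ≤ I a a := fun a => by
    rw [hIq, Prod.norm_def]
    rcases max_choice ‖a.1‖ ‖a.2‖ with h | h <;> rw [h] <;> nlinarith [sq_nonneg ‖a.1‖,
      sq_nonneg ‖a.2‖]
  set P := κ • I - N with hP
  have hPa : ∀ a b, P a b = κ * I a b - N a b := fun a b => rfl
  have hIsymm : ∀ a b, I a b = I b a := fun a b => by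
    rw [hIa, hIa, real_inner_comm, real_inner_comm a.2]
  have hPsymm : ∀ a b, P a b = P b a := fun a b => by rw [hPa, hPa, hIsymm, hN]
  have hPpos : ∀ a, I a a ≤ P a a := fun a => by
    have h1 := (le_abs_self _).trans (N.le_opNorm₂ a a)
    rw [hPa, hκ]
    nlinarith [hIn a, norm_nonneg N]
  set δ : ℝ := e / (2 * (‖P‖ ^ 2 + 1)) with hδ
  have hδ0 : 0 < δ := by positivity
  have hδP : δ * ‖P‖ ^ 2 ≤ e / 2 := by
    rw [hδ, div_mul_eq_mul_div, div_le_iff₀ (by positivity)]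
    nlinarith
  have hδ1 : δ ≤ 1 := by
    rw [hδ, div_le_one (by positivity)]
    nlinarith [sq_nonneg ‖P‖]
  have hcont : ∀ w : E → ℝ, ContinuousOn w (closedBall 0 r) →
      ContinuousOn (fun x => κ / 2 * ‖x‖ ^ 2 - w x) (closedBall 0 r) := fun w hw =>
    (Continuous.continuousOn (by fun_prop)).sub hw
  obtain ⟨k₁, J₁, hJ₁L, hk₁, hk₁0, hk₁low, hk₁c⟩ :=
    exists_smooth_minorant hr.le (hcont w₁ hw₁) (by simp [hw₁0]) hδ0
  obtain ⟨k₂, J₂, hJ₂L, hk₂, hk₂0, hk₂low, hk₂c⟩ :=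
    exists_smooth_minorant hr.le (hcont w₂ hw₂) (by simp [hw₂0]) hδ0
  set J : E × E → E × E →L[ℝ] ℝ := fun η => I (J₁ η.1, J₂ η.2) with hJ
  have hJL : LipschitzWith _ J :=
    I.lipschitz.comp ((hJ₁L.comp LipschitzWith.prod_fst).prodMk
      (hJ₂L.comp LipschitzWith.prod_snd))
  have hg : ∀ η : E × E, HasFDerivAt (fun η : E × E => k₁ η.1 + k₂ η.2) (J η) η := fun η => by
    have h1 := (hk₁ η.1).comp η (hasFDerivAt_fst (𝕜 := ℝ) (E := E) (F := E))
    have h2 := (hk₂ η.2).comp η (hasFDerivAt_snd (𝕜 := ℝ) (E := E) (F := E))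
    exact h1.add h2
  have hlow : ∀ η : E × E, (P - (2 * e) • I) η η / 2 + e / 2 * ‖η‖ ^ 2 ≤ k₁ η.1 + k₂ η.2 := by
    intro η
    set s₁ : E := (InnerProductSpace.toDual ℝ E).symm ((P η).comp (.inl ℝ E E)) with hs₁
    set s₂ : E := (InnerProductSpace.toDual ℝ E).symm ((P η).comp (.inr ℝ E E)) with hs₂
    have hs : ∀ a b, ⟪s₁, a⟫ + ⟪s₂, b⟫ = P η (a, b) := fun a b => by
      rw [hs₁, hs₂, InnerProductSpace.toDual_symm_apply, InnerProductSpace.toDual_symm_apply]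
      simp [← map_add]
    have hPη : ‖P η‖ ≤ ‖P‖ * ‖η‖ := P.le_opNorm η
    have hs₁n : ‖s₁‖ ≤ ‖P‖ * ‖η‖ := by
      rw [hs₁, LinearIsometryEquiv.norm_map]
      refine ((P η).opNorm_comp_le _).trans ((mul_le_of_le_one_right (norm_nonneg _) ?_).trans hPη)
      exact ContinuousLinearMap.norm_inl_le_one ℝ E E
    have hs₂n : ‖s₂‖ ≤ ‖P‖ * ‖η‖ := by
      rw [hs₂, LinearIsometryEquiv.norm_map]
      refine ((P η).opNorm_comp_le _).trans ((mul_le_of_le_one_right (norm_nonneg _) ?_).trans hPη)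
      exact ContinuousLinearMap.norm_inr_le_one ℝ E E
    obtain ⟨ξ₁, hξ₁, h1⟩ := hk₁low η.1 s₁
    obtain ⟨ξ₂, hξ₂, h2⟩ := hk₂low η.2 s₂
    have h3 := hs η.1 η.2
    have h4 := hs ξ₁ ξ₂
    have h5 := hle ξ₁ hξ₁ ξ₂ hξ₂
    have h6 := hPpos (η - (ξ₁, ξ₂))
    have h7 : P (η - (ξ₁, ξ₂)) (η - (ξ₁, ξ₂)) =
        P η η - 2 * P η (ξ₁, ξ₂) + P (ξ₁, ξ₂) (ξ₁, ξ₂) := by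
      simp only [map_sub, sub_apply]
      rw [hPsymm (ξ₁, ξ₂) η]
      ring
    have h8 : P (ξ₁, ξ₂) (ξ₁, ξ₂) = κ * (‖ξ₁‖ ^ 2 + ‖ξ₂‖ ^ 2) - N (ξ₁, ξ₂) (ξ₁, ξ₂) := by
      rw [hPa, hIq]
    have h9 : 0 ≤ I (η - (ξ₁, ξ₂)) (η - (ξ₁, ξ₂)) := (sq_nonneg _).trans (hIn _)
    have h10 : ‖s₁‖ ^ 2 + ‖s₂‖ ^ 2 ≤ 2 * (‖P‖ ^ 2 * ‖η‖ ^ 2) := by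
      have := pow_le_pow_left₀ (norm_nonneg _) hs₁n 2
      have := pow_le_pow_left₀ (norm_nonneg _) hs₂n 2
      rw [mul_pow] at *
      linarith
    have h11 : δ * (‖P‖ ^ 2 * ‖η‖ ^ 2) ≤ e / 2 * ‖η‖ ^ 2 := by
      rw [← mul_assoc]
      exact mul_le_mul_of_nonneg_right hδP (sq_nonneg _)
    have h12 := mul_le_mul_of_nonneg_left h10 hδ0.le
    have h13 := mul_le_mul_of_nonneg_left (hIn η) he0.le
    have h14 : (P - (2 * e) • I) η η = P η η - 2 * e * I η η := rfl
    rw [h14]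
    rw [Prod.mk.eta] at h3
    linarith
  set ρ : ℝ := ε₀ / (2 * κ + 2) with hρ
  have hρ0 : 0 < ρ := by positivity
  have hρε : ρ * (2 * κ + 2) = ε₀ := by rw [hρ]; field_simp
  obtain ⟨η, J', hη, hJη, hJ', hBJ⟩ := exists_twice_differentiable_near_strict_min hg hJL
    (B := P - (2 * e) • I) (fun a b => by
      change P a b - 2 * e * I a b = P b a - 2 * e * I b a
      rw [hPsymm, hIsymm]) (half_pos he0) (by simpa using add_nonpos hk₁0 hk₂0) hlow hρ0
  have hB : ∀ v, I v v / 2 ≤ J' v v := fun v => by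
    refine le_trans ?_ (hBJ v)
    change _ ≤ P v v - 2 * e * I v v
    nlinarith [hPpos v, (sq_nonneg _).trans (hIn v)]
  have hη' : HasFDerivAt J J' (η.1, η.2) := hJ'
  have hi₁ := HasFDerivAt.comp (f := fun x : E => (x, η.2)) η.1 hη'
    (hasFDerivAt_prodMk_left η.1 η.2)
  have hi₂ := HasFDerivAt.comp (f := fun x : E => (η.1, x)) η.2 hη'
    (hasFDerivAt_prodMk_right η.1 η.2)
  set cl := fun T : E →L[ℝ] E × E => (ContinuousLinearMap.compL ℝ E (E × E) ℝ).flip T with hcl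
  have hd₁ : HasFDerivAt (fun x => innerSL ℝ (J₁ x))
      (J'.bilinearComp (.inl ℝ E E) (.inl ℝ E E)) η.1 := by
    refine (((cl (.inl ℝ E E)).hasFDerivAt.comp η.1 hi₁).congr_fderiv ?_).congr_of_eventuallyEq
      (.of_forall fun x => ?_)
    · ext v w; simp [hcl]
    · ext v; simp [hcl, hJ, hIa]
  have hd₂ : HasFDerivAt (fun x => innerSL ℝ (J₂ x))
      (J'.bilinearComp (.inr ℝ E E) (.inr ℝ E E)) η.2 := by
    refine (((cl (.inr ℝ E E)).hasFDerivAt.comp η.2 hi₂).congr_fderiv ?_).congr_of_eventuallyEq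
      (.of_forall fun x => ?_)
    · ext v w; simp [hcl]
    · ext v; simp [hcl, hJ, hIa]
  have hcross₁ : ∀ a b, J' (a, 0) (0, b) = 0 := fun a b => by
    have h1 := (cl (.inr ℝ E E)).hasFDerivAt.comp η.1 hi₁
    have h2 : HasFDerivAt (fun _ : E => innerSL ℝ (J₂ η.2)) (0 : E →L[ℝ] E →L[ℝ] ℝ) η.1 :=
      hasFDerivAt_const _ _
    have h3 := (h1.congr_of_eventuallyEq (f₁ := fun _ : E => innerSL ℝ (J₂ η.2))
      (.of_forall fun x => by ext v; simp [hcl, hJ, hIa])).unique h2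
    simpa [hcl] using congrArg (fun T : E →L[ℝ] E →L[ℝ] ℝ => T a b) h3
  have hcross₂ : ∀ a b, J' (0, b) (a, 0) = 0 := fun a b => by
    have h1 := (cl (.inl ℝ E E)).hasFDerivAt.comp η.2 hi₂
    have h2 : HasFDerivAt (fun _ : E => innerSL ℝ (J₁ η.1)) (0 : E →L[ℝ] E →L[ℝ] ℝ) η.2 :=
      hasFDerivAt_const _ _
    have h3 := (h1.congr_of_eventuallyEq (f₁ := fun _ : E => innerSL ℝ (J₁ η.1))
      (.of_forall fun x => by ext v; simp [hcl, hJ, hIa])).unique h2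
    simpa [hcl] using congrArg (fun T : E →L[ℝ] E →L[ℝ] ℝ => T b a) h3
  have hsplit : ∀ a b, J' (a, b) (a, b) = J' (a, 0) (a, 0) + J' (0, b) (0, b) := fun a b => by
    have : ((a, b) : E × E) = (a, 0) + (0, b) := by simp
    rw [this]
    simp only [map_add, add_apply]
    rw [hcross₁, hcross₂]
    ring
  have hJ₁n : ‖J₁ η.1‖ < ρ := by
    have h1 := (le_abs_self _).trans ((J η).le_opNorm (J₁ η.1, 0))
    simp only [hJ, hIa, inner_zero_right, add_zero, real_inner_self_eq_norm_sq, Prod.norm_mk,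
      norm_zero, norm_nonneg, sup_of_le_left] at h1 hJη
    by_contra! hcon
    nlinarith
  have hJ₂n : ‖J₂ η.2‖ < ρ := by
    have h1 := (le_abs_self _).trans ((J η).le_opNorm (0, J₂ η.2))
    simp only [hJ, hIa, inner_zero_right, zero_add, real_inner_self_eq_norm_sq, Prod.norm_mk,
      norm_zero, norm_nonneg, sup_of_le_right] at h1 hJη
    by_contra! hcon
    nlinarith
  have hx : ∀ a b : E, ‖a‖ ≤ ‖η‖ → ‖b‖ < ρ → ‖a - δ • b‖ < 2 * ρ := fun a b ha hb => by
    have h1 := norm_sub_le a (δ • b)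
    rw [norm_smul, Real.norm_of_nonneg hδ0.le] at h1
    nlinarith [norm_nonneg b]
  have hxε : ∀ x : E, ‖x‖ < 2 * ρ → ‖x‖ < ε₀ := fun x hx => by nlinarith
  have hpε : ∀ x b : E, ‖x‖ < 2 * ρ → ‖b‖ < ρ → ‖κ • x - b‖ < ε := fun x b hx hb => by
    have h1 := norm_sub_le (κ • x) b
    rw [norm_smul, Real.norm_of_nonneg (by linarith)] at h1
    nlinarith
  have hx₁ := hx η.1 (J₁ η.1) (norm_fst_le η) hJ₁n
  have hx₂ := hx η.2 (J₂ η.2) (norm_snd_le η) hJ₂n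
  have hsj₁ := superjet_of_contact (w := w₁) hk₁ (hk₁c η.1) hd₁ (fun v => by
    have := hB (v, 0)
    rw [hIq] at this
    simpa using this) (half_pos he0) (by linarith) ((hxε _ hx₁).trans_le hε₀r)
  have hsj₂ := superjet_of_contact (w := w₂) hk₂ (hk₂c η.2) hd₂ (fun v => by
    have := hB (0, v)
    rw [hIq] at this
    simpa using this) (half_pos he0) (by linarith) ((hxε _ hx₂).trans_le hε₀r)
  set S : (E →L[ℝ] E →L[ℝ] ℝ) → E →L[ℝ] E →L[ℝ] ℝ := fun T =>
    (κ + 2 * (e / 2)) • innerBilin E - (1 / 2 : ℝ) • (T + T.flip) with hS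
  have hSa : ∀ T a b, S T a b = (κ + 2 * (e / 2)) * ⟪a, b⟫ - 1 / 2 * (T a b + T b a) :=
    fun T a b => rfl
  have hSq : ∀ T a, S T a a = (κ + 2 * (e / 2)) * ‖a‖ ^ 2 - T a a := fun T a => by
    rw [hSa, real_inner_self_eq_norm_sq]; ring
  have hSsymm : ∀ T a b, S T a b = S T b a := fun T a b => by
    rw [hSa, hSa, real_inner_comm]; ring
  refine ⟨_, _, _, _, S (J'.bilinearComp (.inl ℝ E E) (.inl ℝ E E)),
    S (J'.bilinearComp (.inr ℝ E E) (.inr ℝ E E)), (hxε _ hx₁).trans_le hε₀ε,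
    (hxε _ hx₂).trans_le hε₀ε,
    hpε _ _ hx₁ hJ₁n, hpε _ _ hx₂ hJ₂n, hSsymm _, hSsymm _, ?_, ?_, ?_⟩
  · filter_upwards [hsj₁] with v hv
    rw [hSq]
    exact hv
  · filter_upwards [hsj₂] with v hv
    rw [hSq]
    exact hv
  · intro a b
    rw [hSq, hSq]
    have h1 := hBJ (a, b)
    rw [hsplit] at h1
    have h2 : (P - (2 * e) • I) (a, b) (a, b) =
        κ * (‖a‖ ^ 2 + ‖b‖ ^ 2) - N (a, b) (a, b) - 2 * e * (‖a‖ ^ 2 + ‖b‖ ^ 2) := by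
      rw [← hIq (a, b)]; rfl
    rw [h2] at h1
    have h3 : 0 ≤ ‖a‖ ^ 2 + ‖b‖ ^ 2 := by positivity
    simp only [ContinuousLinearMap.bilinearComp_apply, ContinuousLinearMap.inl_apply,
      ContinuousLinearMap.inr_apply]
    nlinarith

end Sums
section BilinearMatrices

variable {n : ℕ}

/-- The matrix of a bilinear form in the standard basis. -/
noncomputable def bilinMat
    (B : EuclideanSpace ℝ (Fin n) →L[ℝ] EuclideanSpace ℝ (Fin n) →L[ℝ] ℝ) :
    Matrix (Fin n) (Fin n) ℝ :=
  Matrix.of fun i j => B (basisE i) (basisE j)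

variable {B : EuclideanSpace ℝ (Fin n) →L[ℝ] EuclideanSpace ℝ (Fin n) →L[ℝ] ℝ}

lemma sum_smul_basisE (ξ : EuclideanSpace ℝ (Fin n)) : ∑ i, ξ i • basisE i = ξ := by
  simpa [basisE] using (EuclideanSpace.basisFun (Fin n) ℝ).sum_repr ξ

lemma bilin_eq_sum (ξ η : EuclideanSpace ℝ (Fin n)) :
    B ξ η = ∑ i, ∑ j, ξ i * η j * B (basisE i) (basisE j) := by
  conv_lhs => rw [← sum_smul_basisE ξ, ← sum_smul_basisE η]
  simp only [map_sum, map_smul, sum_apply, smul_apply, smul_eq_mul,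
    Finset.mul_sum]
  rw [Finset.sum_comm]
  exact Finset.sum_congr rfl fun i _ => Finset.sum_congr rfl fun j _ => by ring

lemma dotProduct_bilinMat_mulVec (ξ η : EuclideanSpace ℝ (Fin n)) :
    (ξ : Fin n → ℝ) ⬝ᵥ (bilinMat B).mulVec η = B ξ η := by
  rw [bilin_eq_sum]
  simp only [dotProduct, Matrix.mulVec, bilinMat, Matrix.of_apply, Finset.mul_sum]
  exact Finset.sum_congr rfl fun i _ => Finset.sum_congr rfl fun j _ => by ring

lemma inner_toEuclideanCLM_bilinMat (ξ η : EuclideanSpace ℝ (Fin n)) :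
    ⟪ξ, Matrix.toEuclideanCLM (𝕜 := ℝ) (bilinMat B) η⟫ = B ξ η := by
  rw [Matrix.inner_toEuclideanCLM, ← dotProduct_bilinMat_mulVec]

lemma opNorm_nonneg (M : Matrix (Fin n) (Fin n) ℝ) : 0 ≤ opNorm M := norm_nonneg _

lemma abs_bilin_le (ξ η : EuclideanSpace ℝ (Fin n)) :
    |B ξ η| ≤ opNorm (bilinMat B) * ‖ξ‖ * ‖η‖ := by
  rw [← inner_toEuclideanCLM_bilinMat]
  refine (abs_real_inner_le_norm _ _).trans ?_
  have := (Matrix.toEuclideanCLM (𝕜 := ℝ) (bilinMat B)).le_opNorm η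
  have h := mul_le_mul_of_nonneg_left this (norm_nonneg ξ)
  rw [opNorm]
  linarith

lemma opNorm_bilinMat_le {c : ℝ} (hc : 0 ≤ c)
    (h : ∀ ξ η : EuclideanSpace ℝ (Fin n), ‖ξ‖ = 1 → ‖η‖ = 1 → B ξ η ≤ c) :
    opNorm (bilinMat B) ≤ c := by
  refine ContinuousLinearMap.opNorm_le_of_unit_norm hc fun η hη => ?_
  set T := Matrix.toEuclideanCLM (𝕜 := ℝ) (bilinMat B) with hT
  by_cases h0 : T η = 0
  · rw [h0, norm_zero]; exact hc
  · have h1 := h (‖T η‖⁻¹ • T η) η (norm_smul_inv_norm (𝕜 := ℝ) h0) hη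
    rw [← inner_toEuclideanCLM_bilinMat, ← hT, real_inner_smul_left,
      real_inner_self_eq_norm_sq] at h1
    have : ‖T η‖ ≠ 0 := norm_ne_zero_iff.2 h0
    field_simp at h1
    exact h1

lemma bilinMat_isSymm (h : ∀ a b, B a b = B b a) : (bilinMat B).IsSymm :=
  Matrix.IsSymm.ext fun _ _ => h _ _

lemma bilinMat_posSemidef (h : ∀ a b, B a b = B b a) (h0 : ∀ a, 0 ≤ B a a) :
    (bilinMat B).PosSemidef :=
  .of_dotProduct_mulVec_nonneg (Matrix.IsHermitian.ext fun _ _ => by simpa [bilinMat] using h _ _)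
    fun x => by
      have := dotProduct_bilinMat_mulVec (B := B) (WithLp.toLp 2 x) (WithLp.toLp 2 x)
      simpa [this] using h0 (WithLp.toLp 2 x)

/-- A positive semidefinite form is bounded by its trace. -/
lemma bilin_self_le_trace (h : ∀ a b, B a b = B b a) (h0 : ∀ a, 0 ≤ B a a)
    (ξ : EuclideanSpace ℝ (Fin n)) : B ξ ξ ≤ (bilinMat B).trace * ‖ξ‖ ^ 2 := by
  have hcs : ∀ i, B ξ (basisE i) ^ 2 ≤ B ξ ξ * B (basisE i) (basisE i) := fun i => by
    have := discrim_le_zero (a := B (basisE i) (basisE i)) (b := 2 * B ξ (basisE i)) (c := B ξ ξ)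
      fun t => by
        have h1 := h0 (ξ + t • basisE i)
        simp only [map_add, map_smul, add_apply, smul_apply, smul_eq_mul] at h1
        rw [h (basisE i) ξ] at h1
        linarith
    rw [discrim] at this
    linarith
  have h1 : B ξ ξ = ∑ i, ξ i * B ξ (basisE i) := by
    conv_lhs => rw [← sum_smul_basisE ξ, map_sum]
    simp [sum_smul_basisE]
  have h2 : B ξ ξ ^ 2 ≤ ‖ξ‖ ^ 2 * (B ξ ξ * (bilinMat B).trace) := by
    conv_lhs => rw [h1]
    refine (Finset.sum_mul_sq_le_sq_mul_sq _ _ _).trans ?_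
    rw [EuclideanSpace.real_norm_sq_eq]
    refine mul_le_mul_of_nonneg_left ?_ (Finset.sum_nonneg fun _ _ => sq_nonneg _)
    rw [Matrix.trace, Finset.mul_sum]
    exact Finset.sum_le_sum fun i _ => hcs i
  rcases (h0 ξ).eq_or_lt with h3 | h3
  · rw [← h3]
    exact mul_nonneg (Finset.sum_nonneg fun i _ => h0 _) (sq_nonneg _)
  · nlinarith

end BilinearMatrices
section Jets

variable {n : ℕ} {Ω : Set (EuclideanSpace ℝ (Fin n))}
  {F : EuclideanSpace ℝ (Fin n) → ℝ → EuclideanSpace ℝ (Fin n) → Matrix (Fin n) (Fin n) ℝ → ℝ}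
  {u : EuclideanSpace ℝ (Fin n) → ℝ} {x p : EuclideanSpace ℝ (Fin n)}
  {X : EuclideanSpace ℝ (Fin n) →L[ℝ] EuclideanSpace ℝ (Fin n) →L[ℝ] ℝ}

lemma exists_quadratic_test_function (x p : EuclideanSpace ℝ (Fin n))
    (hX : ∀ a b, X a b = X b a) :
    ∃ φ : EuclideanSpace ℝ (Fin n) → ℝ, ContDiff ℝ 2 φ ∧ gradVec φ x = p ∧
      hessMat φ x = bilinMat X ∧ ∀ z, φ z = ⟪p, z - x⟫ + X (z - x) (z - x) / 2 := by
  set φ : EuclideanSpace ℝ (Fin n) → ℝ :=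
    fun z => ⟪p, z - x⟫ + (1 / 2 : ℝ) * X (z - x) (z - x) with hφ
  have hd : ∀ z, HasFDerivAt φ (innerSL ℝ p + X (z - x)) z := fun z => by
    have h1 : HasFDerivAt (fun z => z - x) (.id ℝ _) z := (hasFDerivAt_id z).sub_const x
    have h2 := (innerSL ℝ p).hasFDerivAt.comp z h1
    have h3 := (X.hasFDerivAt.comp z h1).clm_apply h1
    refine (h2.add (h3.const_mul (1 / 2 : ℝ))).congr_fderiv ?_
    ext v
    simp [hX v]
    ring
  have hfd : fderiv ℝ φ = fun z => innerSL ℝ p + X (z - x) := funext fun z => (hd z).fderiv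
  have hfd2 : fderiv ℝ (fderiv ℝ φ) x = X := by
    rw [hfd]
    have h1 : HasFDerivAt (fun z => z - x) (.id ℝ _) x := (hasFDerivAt_id x).sub_const x
    exact ((X.hasFDerivAt.comp x h1).const_add (innerSL ℝ p)).fderiv
  refine ⟨φ, ?_, ?_, ?_, fun z => by rw [hφ]; ring⟩
  · have h1 : ContDiff ℝ 2 fun z => z - x := contDiff_id.sub contDiff_const
    exact (contDiff_const.inner ℝ h1).add
      (contDiff_const.mul ((X.contDiff.comp h1).clm_apply h1))
  · ext i
    simp [gradVec, hfd, EuclideanSpace.inner_single_right]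
  · ext i j
    simp [hessMat, iteratedFDeriv_two_apply, hfd2, bilinMat, basisE]

lemma eventually_nhds_zero_add {P : EuclideanSpace ℝ (Fin n) → Prop}
    (h : ∀ᶠ v in 𝓝 (0 : EuclideanSpace ℝ (Fin n)), P v) : ∀ᶠ z in 𝓝 x, P (z - x) := by
  have : Tendsto (fun z => z - x) (𝓝 x) (𝓝 0) := by
    simpa using (continuous_sub_right x).tendsto x
  exact this.eventually h

lemma IsViscositySubsolution.le_zero_of_superjet (hu : IsViscositySubsolution Ω F u)
    (hx : x ∈ Ω) (hX : ∀ a b, X a b = X b a)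
    (h : ∀ᶠ v in 𝓝 (0 : EuclideanSpace ℝ (Fin n)), u (x + v) ≤ u x + ⟪p, v⟫ + X v v / 2) :
    F x (u x) p (bilinMat X) ≤ 0 := by
  obtain ⟨φ, hφ, rfl, h2, h3⟩ := exists_quadratic_test_function x p hX
  rw [← h2]
  refine hu.2 φ hφ x hx (Filter.Eventually.filter_mono nhdsWithin_le_nhds ?_)
  filter_upwards [eventually_nhds_zero_add (x := x) h] with z hz
  rw [add_sub_cancel] at hz
  simp only [h3, sub_self, map_zero, inner_zero_right]
  linarith

lemma IsViscositySupersolution.zero_le_of_subjet (hu : IsViscositySupersolution Ω F u)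
    (hx : x ∈ Ω) (hX : ∀ a b, X a b = X b a)
    (h : ∀ᶠ v in 𝓝 (0 : EuclideanSpace ℝ (Fin n)), u x + ⟪p, v⟫ + X v v / 2 ≤ u (x + v)) :
    0 ≤ F x (u x) p (bilinMat X) := by
  obtain ⟨φ, hφ, rfl, h2, h3⟩ := exists_quadratic_test_function x p hX
  rw [← h2]
  refine hu.2 φ hφ x hx (Filter.Eventually.filter_mono nhdsWithin_le_nhds ?_)
  filter_upwards [eventually_nhds_zero_add (x := x) h] with z hz
  rw [add_sub_cancel] at hz
  simp only [h3, sub_self, map_zero, inner_zero_right]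
  linarith

end Jets

section Estimate

variable {n : ℕ}
  {F : EuclideanSpace ℝ (Fin n) → ℝ → EuclideanSpace ℝ (Fin n) → Matrix (Fin n) (Fin n) ℝ → ℝ}

lemma UniformlyElliptic.apply_bilinMat {lam Lam : ℝ} (hF : UniformlyElliptic lam Lam F)
    {X Y : EuclideanSpace ℝ (Fin n) →L[ℝ] EuclideanSpace ℝ (Fin n) →L[ℝ] ℝ}
    (hX : ∀ a b, X a b = X b a) (hY : ∀ a b, Y a b = Y b a) (hXY : ∀ a, Y a a ≤ X a a)
    (x : EuclideanSpace ℝ (Fin n)) (z : ℝ) (p : EuclideanSpace ℝ (Fin n)) :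
    lam * (bilinMat (X - Y)).trace ≤ F x z p (bilinMat Y) - F x z p (bilinMat X) ∧
      F x z p (bilinMat Y) - F x z p (bilinMat X) ≤ Lam * (bilinMat (X - Y)).trace := by
  have h : bilinMat (X - Y) = bilinMat X - bilinMat Y := rfl
  rw [h]
  refine hF x z p _ _ (bilinMat_isSymm hX) (bilinMat_isSymm hY) ?_
  rw [← h]
  exact bilinMat_posSemidef (fun a b => by simp [hX a b, hY a b]) fun a => by simpa using hXY a

lemma trace_bilinMat_smul_innerBilin (m : ℝ) :
    (bilinMat (m • innerBilin (EuclideanSpace ℝ (Fin n)))).trace = n * m := by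
  simp [Matrix.trace, bilinMat, basisE]

/-- The block matrix inequality bounds the entries of the first block. -/
lemma opNorm_le_of_block_bound {E : Type*} [NormedAddCommGroup E] [InnerProductSpace ℝ E]
    {X Y : E →L[ℝ] E →L[ℝ] ℝ} {M : E × E →L[ℝ] E × E →L[ℝ] ℝ} {ε z₁ z z₂ d t : ℝ}
    (hX : ∀ a b, X a b = X b a) (hY : ∀ a b, Y a b = Y b a) (hM : ∀ a b, M a b = M b a)
    (hXY : ∀ a b, X a a + Y b b ≤ M (a, b) (a, b) + ε * (‖a‖ ^ 2 + ‖b‖ ^ 2))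
    (hz₁ : ∀ a, ‖a‖ = 1 → M (a, a) (a, a) ≤ z₁)
    (hz : ∀ a b, ‖a‖ = 1 → ‖b‖ = 1 → M (a, -a) (b, b) ≤ z)
    (hz₂ : ∀ a, ‖a‖ = 1 → M (a, -a) (a, -a) ≤ z₂)
    (hd : ∀ a, |X a a + Y a a| ≤ d * ‖a‖ ^ 2) (ht : 0 < t)
    {ξ η : E} (hξ : ‖ξ‖ = 1) (hη : ‖η‖ = 1) :
    X ξ η ≤ ((z₁ + d + 2 * ε) / (2 * t) + z + t * (z₂ + d + 2 * ε) / 2 + d) / 2 := by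
  have h1 := hXY (ξ + t • η) (ξ - t • η)
  have h2 : ((ξ + t • η, ξ - t • η) : E × E) = (ξ, ξ) + t • (η, -η) := by
    ext <;> simp [sub_eq_add_neg]
  have h3 := hz₁ ξ hξ
  have h4 := hz η ξ hη hξ
  have h5 := hz₂ η hη
  have h6 := (abs_le.1 (hd ξ)).1
  have h7 := (abs_le.1 (hd η)).1
  have h8 := (abs_le.1 (hd (ξ + η))).2
  have h9 := (abs_le.1 (hd (ξ - η))).1
  have h10 : ‖ξ + t • η‖ ^ 2 + ‖ξ - t • η‖ ^ 2 = 2 * (1 + t ^ 2) := by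
    have := parallelogram_law_with_norm ℝ ξ (t • η)
    rw [norm_smul, hξ, hη, Real.norm_of_nonneg ht.le] at this
    linarith
  have h11 : ‖ξ + η‖ ^ 2 + ‖ξ - η‖ ^ 2 = 4 := by
    have := parallelogram_law_with_norm ℝ ξ η
    rw [hξ, hη] at this
    linarith
  rw [h10, h2] at h1
  simp only [map_add, map_sub, map_smul, add_apply, sub_apply, smul_apply, smul_eq_mul] at h1 h8 h9
  rw [hX η ξ, hY η ξ, hM (ξ, ξ) (η, -η)] at h1
  rw [hX η ξ, hY η ξ] at h8 h9
  rw [hξ] at h6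
  rw [hη] at h7
  have h12 : X ξ η + Y ξ η ≤ d := by
    have : d * ‖ξ + η‖ ^ 2 + d * ‖ξ - η‖ ^ 2 = d * 4 := by rw [← mul_add, h11]
    linarith
  have h13 : 2 * t * (X ξ η - Y ξ η) ≤ z₁ + 2 * t * z + t ^ 2 * z₂ + (1 + t ^ 2) * (d + 2 * ε) := by
    linarith [mul_le_mul_of_nonneg_left h4 ht.le, mul_le_mul_of_nonneg_left h5 (sq_nonneg t),
      mul_le_mul_of_nonneg_left h7 (sq_nonneg t)]
  have h14 : X ξ η - Y ξ η ≤ (z₁ + d + 2 * ε) / (2 * t) + z + t * (z₂ + d + 2 * ε) / 2 := by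
    rw [← mul_le_mul_iff_right₀ (show 0 < 2 * t by positivity)]
    refine h13.trans (le_of_eq ?_)
    field_simp
    ring
  linarith

set_option maxHeartbeats 1000000 in
/-- The ellipticity estimate for the two Hessians given by the theorem on sums. -/
lemma elliptic_block_estimate {lam Lam ω ε S z₁ z z₂ : ℝ} (hlam : 0 < lam) (hLam : 0 ≤ Lam)
    (hF : UniformlyElliptic lam Lam F)
    {X Y : EuclideanSpace ℝ (Fin n) →L[ℝ] EuclideanSpace ℝ (Fin n) →L[ℝ] ℝ}
    {M : EuclideanSpace ℝ (Fin n) × EuclideanSpace ℝ (Fin n) →L[ℝ]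
      EuclideanSpace ℝ (Fin n) × EuclideanSpace ℝ (Fin n) →L[ℝ] ℝ}
    (hX : ∀ a b, X a b = X b a) (hY : ∀ a b, Y a b = Y b a) (hM : ∀ a b, M a b = M b a)
    (hXY : ∀ a b, X a a + Y b b ≤ M (a, b) (a, b) + ε * (‖a‖ ^ 2 + ‖b‖ ^ 2))
    (hz₁ : ∀ a, M (a, a) (a, a) ≤ z₁ * ‖a‖ ^ 2)
    (hz : ∀ a b, ‖a‖ = 1 → ‖b‖ = 1 → M (a, -a) (b, b) ≤ z)
    (hz₂ : ∀ a, ‖a‖ = 1 → M (a, -a) (a, -a) ≤ z₂)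
    (hz₁0 : 0 ≤ z₁) (hz0 : 0 ≤ z) (hz₂0 : 0 ≤ z₂)
    (hε : 0 < ε) (hω : 0 < ω) (hωlam : ω ≤ lam / 4) (hεω : ε ≤ ω)
    {x y p q : EuclideanSpace ℝ (Fin n)} {a b : ℝ} (hx : F x a p (bilinMat X) ≤ 0)
    (hy : 0 ≤ F y b q (bilinMat (-Y)))
    (hstr : F y b q (bilinMat X) - F x a p (bilinMat X) ≤ ω * (S + opNorm (bilinMat X)))
    {e : EuclideanSpace ℝ (Fin n)} (he : ‖e‖ = 1) :
    -(lam / 2) * M (e, -e) (e, -e) ≤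
      (Lam * n + lam) * (z₁ + 2 * ω) + lam * ω + ω * (S + z) + ω ^ 2 * z₂ / lam := by
  set m := z₁ + 2 * ε with hm
  set I := m • innerBilin (EuclideanSpace ℝ (Fin n)) with hI
  have hIa : ∀ a b, I a b = m * ⟪a, b⟫ := fun a b => rfl
  have hIsymm : ∀ a b, I a b = I b a := fun a b => by rw [hIa, hIa, real_inner_comm]
  have hIq : ∀ a, I a a = m * ‖a‖ ^ 2 := fun a => by rw [hIa, real_inner_self_eq_norm_sq]
  set G := (-Y + I) - X with hG
  have hGa : ∀ a b, G a b = I a b - (X a b + Y a b) := fun a b => by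
    simp only [hG, sub_apply, add_apply, neg_apply]
    ring
  have hGsymm : ∀ a b, G a b = G b a := fun a b => by rw [hGa, hGa, hIsymm, hX, hY]
  have hD : ∀ a, X a a + Y a a ≤ m * ‖a‖ ^ 2 := fun a => by
    linarith [hXY a a, hz₁ a]
  have hG0 : ∀ a, 0 ≤ G a a := fun a => by rw [hGa, hIq]; linarith [hD a]
  set θ := (bilinMat G).trace with hθ
  have hGθ : ∀ a, G a a ≤ θ * ‖a‖ ^ 2 := bilin_self_le_trace hGsymm hG0
  have hm0 : 0 ≤ m := by positivity
  have hθe : 0 ≤ θ := by simpa [he] using (hG0 e).trans (hGθ e)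
  have hd : ∀ a, |X a a + Y a a| ≤ (m + θ) * ‖a‖ ^ 2 := fun a => by
    have h1 := hGθ a
    rw [hGa, hIq] at h1
    have h2 := mul_nonneg hm0 (sq_nonneg ‖a‖)
    have h3 := mul_nonneg hθe (sq_nonneg ‖a‖)
    rw [abs_le]
    constructor <;> linarith [hD a]
  have hYs : ∀ a b, (-Y) a b = (-Y) b a := fun a b => by simp [hY a b]
  have hPs : ∀ a b, (-Y + I) a b = (-Y + I) b a := fun a b => by
    rw [add_apply, add_apply, add_apply, add_apply, hYs, hIsymm]
  have h1 := (hF.apply_bilinMat hPs hX (fun a => by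
    have := hG0 a
    rw [hG, sub_apply, sub_apply] at this
    linarith) y b q).1
  have h2 := (hF.apply_bilinMat hPs hYs (fun a => by
    rw [add_apply, add_apply, hIq]
    linarith [mul_nonneg hm0 (sq_nonneg ‖a‖)]) y b q).2
  rw [show -Y + I - -Y = I by abel, hI, trace_bilinMat_smul_innerBilin] at h2
  set t := ω / lam with ht
  have ht0 : 0 < t := by positivity
  set κ := ((z₁ + (m + θ) + 2 * ε) / (2 * t) + z + t * (z₂ + (m + θ) + 2 * ε) / 2 + (m + θ)) / 2
    with hκ
  have hκ0 : 0 ≤ κ := by positivity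
  have hXn : opNorm (bilinMat X) ≤ κ := opNorm_bilinMat_le hκ0 fun ξ η hξ hη =>
    opNorm_le_of_block_bound hX hY hM hXY (fun a ha => by simpa [ha] using hz₁ a) hz hz₂ hd ht0
      hξ hη
  have hωκ : ω * κ = lam / 4 * (2 * m + θ) + ω * z / 2 +
      ω ^ 2 / (4 * lam) * (z₂ + m + θ + 2 * ε) + ω / 2 * (m + θ) := by
    rw [hκ, ht, hm]
    field_simp
    ring
  have hω2 : ω ^ 2 / (4 * lam) ≤ lam / 64 := by
    rw [div_le_iff₀ (by positivity)]
    nlinarith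
  have hmain : lam * θ ≤ Lam * (n * m) + ω * (S + κ) := by
    have := mul_le_mul_of_nonneg_left hXn hω.le
    linarith
  have h3 : ω ^ 2 / (4 * lam) * (z₂ + m + θ + 2 * ε) ≤
      ω ^ 2 / (4 * lam) * z₂ + lam / 64 * (2 * m + θ) := by
    have : 2 * ε ≤ m := by linarith
    have := mul_le_mul_of_nonneg_right hω2 (show 0 ≤ 2 * m + θ by positivity)
    have := mul_le_mul_of_nonneg_left (show m + θ + 2 * ε ≤ 2 * m + θ by linarith)
      (show 0 ≤ ω ^ 2 / (4 * lam) by positivity)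
    linarith
  have h4 : ω / 2 * (m + θ) ≤ lam / 8 * (m + θ) :=
    mul_le_mul_of_nonneg_right (by linarith) (by positivity)
  have h5 : ω ^ 2 / (4 * lam) * z₂ ≤ ω ^ 2 * z₂ / lam := by
    rw [div_mul_eq_mul_div]
    exact div_le_div_of_nonneg_left (by positivity) hlam (by linarith)
  have h6 : lam / 2 * θ ≤ (Lam * n + lam) * m + ω * (S + z) + ω ^ 2 * z₂ / lam := by
    nlinarith [mul_nonneg hlam.le hθe, mul_nonneg hlam.le hm0, mul_nonneg hω.le hz0]
  have h7 : -M (e, -e) (e, -e) - 2 * ε ≤ θ := by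
    have h8 := hGθ e
    have h9 := hXY e (-e)
    rw [hGa, hIq, he] at h8
    simp only [map_neg, neg_apply, neg_neg, norm_neg, he] at h9
    linarith
  have h8 : (Lam * n + lam) * m ≤ (Lam * n + lam) * (z₁ + 2 * ω) :=
    mul_le_mul_of_nonneg_left (by linarith) (by positivity)
  have h9 := mul_le_mul_of_nonneg_left h7 (half_pos hlam).le
  have h10 := mul_le_mul_of_nonneg_left hεω hlam.le
  linarith

end Estimate

section Jets

variable {E : Type*} [NormedAddCommGroup E] [InnerProductSpace ℝ E] [FiniteDimensional ℝ E]

/-- Second order jets of `u` near the two components of a maximum point of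
`u x - u y - Φ (x, y)`. -/
lemma exists_jets_of_isMax {u : E → ℝ} {Ω : Set E} {Q : Set (E × E)} {Φ : E × E → ℝ}
    (hu : ContinuousOn u Ω) (hQ : IsOpen Q) (hQΩ : Q ⊆ Ω ×ˢ Ω)
    (hΦ : ContDiffOn ℝ 2 Φ Q) {x₀ y₀ : E} (hpm : (x₀, y₀) ∈ Q)
    (hmax : ∀ p ∈ Q, u p.1 - u p.2 - Φ p ≤ u x₀ - u y₀ - Φ (x₀, y₀)) {p₀ q₀ : E}
    (hD : ∀ a b, fderiv ℝ Φ (x₀, y₀) (a, b) = ⟪p₀, a⟫ - ⟪q₀, b⟫) {ε : ℝ} (hε : 0 < ε) :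
    ∃ (x y p q : E) (X Y : E →L[ℝ] E →L[ℝ] ℝ), x ∈ Ω ∧ y ∈ Ω ∧ ‖x - x₀‖ < ε ∧ ‖y - y₀‖ < ε ∧
      ‖p - p₀‖ < ε ∧ ‖q - q₀‖ < ε ∧ (∀ a b, X a b = X b a) ∧ (∀ a b, Y a b = Y b a) ∧
      (∀ᶠ v in 𝓝 0, u (x + v) ≤ u x + ⟪p, v⟫ + X v v / 2) ∧
      (∀ᶠ v in 𝓝 0, u y + ⟪q, v⟫ + (-Y) v v / 2 ≤ u (y + v)) ∧
      ∀ a b, X a a + Y b b ≤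
        fderiv ℝ (fderiv ℝ Φ) (x₀, y₀) (a, b) (a, b) + ε * (‖a‖ ^ 2 + ‖b‖ ^ 2) := by
  set M := fderiv ℝ (fderiv ℝ Φ) (x₀, y₀) with hM
  have hcd : ContDiffAt ℝ 2 Φ (x₀, y₀) := hΦ.contDiffAt (hQ.mem_nhds hpm)
  have hMs : ∀ a b, M a b = M b a := fun a b =>
    hcd.isSymmSndFDerivAt (by simp) a b
  have htay := second_order_expansion (g := Φ) (J := fderiv ℝ Φ) (J' := M) (x := (x₀, y₀))
    (by
      filter_upwards [hQ.mem_nhds hpm] with z hz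
      exact ((hΦ.contDiffAt (hQ.mem_nhds hz)).differentiableAt (by simp)).hasFDerivAt)
    ((hcd.fderiv_right (m := 1) (by norm_num)).differentiableAt (by simp)).hasFDerivAt
    (σ := ε / 4) (by positivity)
  have hQ' : ∀ᶠ v in 𝓝 (0 : E × E), (x₀, y₀) + v ∈ Q := by
    have : Tendsto (fun v => (x₀, y₀) + v) (𝓝 0) (𝓝 (x₀, y₀)) := by
      simpa using (continuous_const_add (x₀, y₀)).tendsto (0 : E × E)
    exact this.eventually (hQ.mem_nhds hpm)
  obtain ⟨r, hr, hball⟩ := Metric.nhds_basis_closedBall.eventually_iff.1 (htay.and hQ')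
  have hmem : ∀ x ∈ closedBall (0 : E) r, ∀ y ∈ closedBall (0 : E) r,
      (x, y) ∈ closedBall (0 : E × E) r := fun x hx y hy => by
    rw [← Prod.mk_zero_zero, ← closedBall_prod_same]
    exact ⟨hx, hy⟩
  have h0 : (0 : E) ∈ closedBall (0 : E) r := mem_closedBall_self hr.le
  have hΩx : ∀ v ∈ closedBall (0 : E) r, x₀ + v ∈ Ω := fun v hv =>
    (hQΩ (hball (hmem v hv 0 h0)).2).1
  have hΩy : ∀ v ∈ closedBall (0 : E) r, y₀ + v ∈ Ω := fun v hv =>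
    (hQΩ (hball (hmem 0 h0 v hv)).2).2
  set N : E × E →L[ℝ] E × E →L[ℝ] ℝ := M + (ε / 2) •
    ((innerBilin E).bilinearComp (.fst ℝ E E) (.fst ℝ E E) +
      (innerBilin E).bilinearComp (.snd ℝ E E) (.snd ℝ E E)) with hN
  have hNa : ∀ a b : E × E, N a b = M a b + ε / 2 * (⟪a.1, b.1⟫ + ⟪a.2, b.2⟫) := fun a b => rfl
  obtain ⟨x, y, p, q, X, Y, hx, hy, hp, hq, hX, hY, hjx, hjy, hb⟩ := theorem_on_sums
    (w₁ := fun v => u (x₀ + v) - u x₀ - ⟪p₀, v⟫) (w₂ := fun v => -(u (y₀ + v) - u y₀) + ⟪q₀, v⟫)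
    (N := N) hr
    (((hu.comp (continuous_const_add x₀).continuousOn hΩx).sub continuousOn_const).sub
      (by fun_prop))
    (((hu.comp (continuous_const_add y₀).continuousOn hΩy).sub continuousOn_const).neg.add
      (by fun_prop)) (by simp) (by simp)
    (fun a b => by rw [hNa, hNa, hMs, real_inner_comm, real_inner_comm b.2])
    (fun a ha b hb => by
      obtain ⟨h1, h2⟩ := hball (hmem a ha b hb)
      have h3 := hmax _ h2
      have h4 := (abs_le.1 h1).2
      have h5 : ‖((a, b) : E × E)‖ ^ 2 ≤ ‖a‖ ^ 2 + ‖b‖ ^ 2 := by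
        rw [Prod.norm_mk]
        rcases max_choice ‖a‖ ‖b‖ with h | h <;> rw [h] <;>
          linarith [sq_nonneg ‖a‖, sq_nonneg ‖b‖]
      have h6 := mul_le_mul_of_nonneg_left h5 hε.le
      rw [hD] at h4
      rw [hNa, real_inner_self_eq_norm_sq, real_inner_self_eq_norm_sq]
      simp only [Prod.mk_add_mk] at h3 h4
      linarith)
    (lt_min (half_pos hε) hr)
  have hx' : x₀ + x ∈ Ω := hΩx x (by simpa using (hx.trans_le (min_le_right _ _)).le)
  have hy' : y₀ + y ∈ Ω := hΩy y (by simpa using (hy.trans_le (min_le_right _ _)).le)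
  have hsmall : min (ε / 2) r < ε := (min_le_left _ _).trans_lt (half_lt_self hε)
  refine ⟨x₀ + x, y₀ + y, p₀ + p, q₀ - q, X, Y, hx', hy', ?_, ?_, ?_, ?_, hX, hY, ?_, ?_, ?_⟩
  · simpa using hx.trans hsmall
  · simpa using hy.trans hsmall
  · simpa using hp.trans hsmall
  · simpa using hq.trans hsmall
  · filter_upwards [hjx] with v hv
    rw [inner_add_right] at hv
    rw [inner_add_left, add_assoc x₀]
    linarith
  · filter_upwards [hjy] with v hv
    rw [inner_add_right] at hv
    rw [inner_sub_left, add_assoc y₀, neg_apply, neg_apply]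
    linarith
  · intro a b
    have h1 := hb a b
    rw [hNa, real_inner_self_eq_norm_sq, real_inner_self_eq_norm_sq] at h1
    have h2 := mul_le_mul_of_nonneg_right (min_le_left (ε / 2) r)
      (show 0 ≤ ‖a‖ ^ 2 + ‖b‖ ^ 2 by positivity)
    linarith

end Jets

section Derivatives

variable {n : ℕ} {Q : Set (EuclideanSpace ℝ (Fin n) × EuclideanSpace ℝ (Fin n))}
  {Φ : EuclideanSpace ℝ (Fin n) × EuclideanSpace ℝ (Fin n) → ℝ}
  {pm : EuclideanSpace ℝ (Fin n) × EuclideanSpace ℝ (Fin n)}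

lemma inner_toLp_apply_basisE (l : EuclideanSpace ℝ (Fin n) →L[ℝ] ℝ)
    (v : EuclideanSpace ℝ (Fin n)) :
    ⟪(WithLp.equiv 2 (Fin n → ℝ)).symm fun i => l (basisE i), v⟫ = l v := by
  conv_rhs => rw [← sum_smul_basisE v]
  simp [PiLp.inner_apply]

lemma inner_Z0vec (hQ : IsOpen Q) (hpm : pm ∈ Q) (v : EuclideanSpace ℝ (Fin n)) :
    ⟪Z0vec Q Φ pm, v⟫ = fderiv ℝ Φ pm (v, v) := by
  have := inner_toLp_apply_basisE
    ((fderiv ℝ Φ pm).comp ((ContinuousLinearMap.id ℝ _).prod (.id ℝ _))) v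
  rw [Z0vec, fderivWithin_of_isOpen hQ hpm]
  exact this

lemma inner_Wvec (hQ : IsOpen Q) (hpm : pm ∈ Q) (v : EuclideanSpace ℝ (Fin n)) :
    ⟪Wvec Q Φ pm, v⟫ = fderiv ℝ Φ pm (v, -v) := by
  have := inner_toLp_apply_basisE
    ((fderiv ℝ Φ pm).comp ((ContinuousLinearMap.id ℝ _).prod (-.id ℝ _))) v
  rw [Wvec, fderivWithin_of_isOpen hQ hpm]
  exact this

lemma Z1mat_eq_bilinMat (hQ : IsOpen Q) (hpm : pm ∈ Q) :
    Z1mat Q Φ pm = bilinMat ((fderiv ℝ (fderiv ℝ Φ) pm).bilinearComp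
      ((ContinuousLinearMap.id ℝ _).prod (.id ℝ _))
      ((ContinuousLinearMap.id ℝ _).prod (.id ℝ _))) := by
  ext i j
  simp [Z1mat, bilinMat, iteratedFDerivWithin_of_isOpen 2 hQ hpm, iteratedFDeriv_two_apply]

lemma Z2mat_eq_bilinMat (hQ : IsOpen Q) (hpm : pm ∈ Q) :
    Z2mat Q Φ pm = bilinMat ((fderiv ℝ (fderiv ℝ Φ) pm).bilinearComp
      ((ContinuousLinearMap.id ℝ _).prod (-.id ℝ _))
      ((ContinuousLinearMap.id ℝ _).prod (-.id ℝ _))) := by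
  ext i j
  simp [Z2mat, bilinMat, iteratedFDerivWithin_of_isOpen 2 hQ hpm, iteratedFDeriv_two_apply]

lemma Zmat_eq_bilinMat (hQ : IsOpen Q) (hpm : pm ∈ Q) :
    Zmat Q Φ pm = bilinMat ((fderiv ℝ (fderiv ℝ Φ) pm).bilinearComp
      ((ContinuousLinearMap.id ℝ _).prod (-.id ℝ _))
      ((ContinuousLinearMap.id ℝ _).prod (.id ℝ _))) := by
  ext i j
  simp [Zmat, bilinMat, iteratedFDerivWithin_of_isOpen 2 hQ hpm, iteratedFDeriv_two_apply]

lemma trace_UpsMat_mul_bilinMat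
    (B : EuclideanSpace ℝ (Fin n) →L[ℝ] EuclideanSpace ℝ (Fin n) →L[ℝ] ℝ) :
    (UpsMat pm * bilinMat B).trace =
      B (‖pm.1 - pm.2‖⁻¹ • (pm.1 - pm.2)) (‖pm.1 - pm.2‖⁻¹ • (pm.1 - pm.2)) := by
  rw [bilin_eq_sum, Finset.sum_comm]
  simp only [Matrix.trace, Matrix.diag, Matrix.mul_apply]
  refine Finset.sum_congr rfl fun i _ => Finset.sum_congr rfl fun j _ => ?_
  simp only [UpsMat, bilinMat, Matrix.of_apply, PiLp.smul_apply, PiLp.sub_apply, smul_eq_mul]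
  ring

end Derivatives

/-- The modulus in the structure condition at perturbed points and slopes is controlled by the
one at the unperturbed data. -/
lemma structure_modulus_le {mu beta Lam A d z d' P R r ε : ℝ} (hmu : 0 ≤ mu) (hbeta : 0 ≤ beta)
    (hLam : 0 ≤ Lam) (hA : 0 ≤ A) (hd : 0 ≤ d) (hz : 0 ≤ z) (hd'0 : 0 ≤ d') (hP : 0 ≤ P)
    (hR : 0 ≤ R) (hr : 0 ≤ r) (hε : ε ≤ 1 / 8) (hεd : ε ≤ d / 8) (hd' : d' ≤ d + 2 * ε)
    (hPR : P + R ≤ A + 2 * ε) (hrz : r ≤ z + 2 * ε) :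
    mu * (d' * (1 + P + R) + r / (1 + P + R)) ^ beta ≤
      mu * (2 * (1 + Lam)) ^ beta * ((1 + A) * d + z / (1 + Lam)) ^ beta := by
  rw [mul_assoc, ← Real.mul_rpow (by positivity) (by positivity)]
  refine mul_le_mul_of_nonneg_left (Real.rpow_le_rpow (by positivity) ?_ hbeta) hmu
  have h1 : r / (1 + P + R) ≤ r := div_le_self hr (by linarith)
  have h2 : d' * (1 + P + R) ≤ 5 / 4 * d * (1 + A + 1 / 4) :=
    mul_le_mul (by linarith) (by linarith) (by positivity) (by positivity)
  have h3 : 2 * (1 + Lam) * ((1 + A) * d + z / (1 + Lam)) =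
      2 * ((1 + A) * d) + 2 * Lam * ((1 + A) * d) + 2 * z := by
    field_simp
  rw [h3]
  nlinarith [mul_nonneg hA hd, mul_nonneg hLam (mul_nonneg (show 0 ≤ 1 + A by linarith) hd)]

/-- The absorption of the error terms, both for small and for large values of `ω`. -/
lemma absorb_error_terms {lam K A ω z₁ z z₂ t : ℝ} (hlam : 0 < lam) (hK : 0 ≤ K) (hω : 0 < ω)
    (hz₁ : 0 ≤ z₁) (hz : 0 ≤ z) (hz₂ : 0 ≤ z₂) (ht : |t| ≤ z₂)
    (h : ω ≤ lam / 4 → -(lam / 2) * t ≤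
      K * (z₁ + 2 * ω) + lam * ω + ω * (A ^ 2 + 5 + z) + ω ^ 2 * z₂ / lam) :
    -(lam / 2 - 2 * 1 * ω) * t ≤
      (2 * K + lam + 6 + 9 / lam) * (z₁ + (1 + A ^ 2 + z) * ω + z₂ * ω ^ 2) := by
  have hrhs : z₁ * K + ω * (2 * K + lam + 5 + A ^ 2 + z) + 9 / lam * (z₂ * ω ^ 2) ≤
      (2 * K + lam + 6 + 9 / lam) * (z₁ + (1 + A ^ 2 + z) * ω + z₂ * ω ^ 2) := by
    set j := 9 / lam
    have hj : 0 ≤ j := by positivity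
    have h1 : 0 ≤ (A ^ 2 + z) * ω := by positivity
    have h2 : 0 ≤ z₂ * ω ^ 2 := by positivity
    have h3 : 0 ≤ (2 * K + lam + 5 + j) * ((A ^ 2 + z) * ω) := by positivity
    have h4 : 0 ≤ (2 * K + lam + 6) * (z₂ * ω ^ 2) := by positivity
    have h5 : 0 ≤ (K + lam + 6 + j) * z₁ := by positivity
    have h6 : 0 ≤ (1 + j) * ω := by positivity
    linarith
  refine le_trans ?_ hrhs
  have hrhs1 : 0 ≤ z₁ * K + ω * (2 * K + lam + 5 + A ^ 2 + z) := by positivity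
  have hrhs2 : 0 ≤ 9 / lam * (z₂ * ω ^ 2) := by positivity
  rcases lt_or_ge (lam / 4) ω with hωlam | hωlam
  · have h1 : -(lam / 2 - 2 * 1 * ω) * t ≤ 2 * ω * z₂ := by
      refine (mul_le_mul_of_nonneg_left ((le_abs_self t).trans ht) (by linarith)).trans ?_
      exact mul_le_mul_of_nonneg_right (by linarith) hz₂
    have h2 : 2 * ω * z₂ ≤ 9 / lam * (z₂ * ω ^ 2) := by
      rw [div_mul_eq_mul_div, le_div_iff₀ hlam]
      have := mul_le_mul_of_nonneg_left hωlam.le (mul_nonneg hω.le hz₂)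
      have := mul_nonneg hz₂ (sq_nonneg ω)
      linarith
    linarith
  rcases le_or_gt 0 t with ht0 | ht0
  · have := mul_nonneg (show 0 ≤ lam / 2 - 2 * 1 * ω by linarith) ht0
    linarith
  have h1 : ω ^ 2 * z₂ / lam ≤ 9 / lam * (z₂ * ω ^ 2) := by
    rw [div_mul_eq_mul_div]
    refine div_le_div_of_nonneg_right ?_ hlam.le
    linarith [mul_nonneg hz₂ (sq_nonneg ω)]
  have h2 := mul_nonneg hω.le (neg_nonneg.2 ht0.le)
  linarith [h hωlam]

/-- The zeroth order factor in the structure condition at perturbed slopes. -/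
lemma structure_factor_le {A P R ε o : ℝ} (hP0 : 0 ≤ P) (hR0 : 0 ≤ R) (hε : ε ≤ 1 / 8)
    (hP : P ≤ A / 2 + ε) (hR : R ≤ A / 2 + ε) : 1 + R ^ 2 + P ^ 2 + o ≤ A ^ 2 + 5 + o := by
  nlinarith [sq_nonneg (A - 1), pow_le_pow_left₀ hP0 (hP.trans (add_le_add_right hε _)) 2,
    pow_le_pow_left₀ hR0 (hR.trans (add_le_add_right hε _)) 2]

end

/-- **Necessary condition at an interior positive maximum** (inequality (22)).
If `u(x) − u(y) − Φ(x,y)` attains a positive maximum over `Q` at an interior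
point `(x̄,ȳ)`, then the inequality
`−(λ/2 − 2C₁ω)·Tr(Υ Z₂) ≤ C[‖Z₁‖ + (1 + A² + ‖Z‖)ω + ‖Z₂‖ω²]` holds at
`(x̄,ȳ)`, where the constants `C₁, C₂, C` depend only on `n, λ, Λ, μ, β`. -/
theorem necessary_condition_at_interior_max {n : ℕ}
    (lam Lam mu beta : ℝ)
    (hlam : 0 < lam) (hlamLam : lam ≤ Lam)
    (hmu : 0 < mu) (hbeta : 0 < beta) (hbeta1 : beta ≤ 1) :
    ∃ C₁ C₂ C : ℝ, 0 < C₁ ∧ 0 < C₂ ∧ 0 < C ∧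
      ∀ (Ω : Set (EuclideanSpace ℝ (Fin n))), IsOpen Ω →
        Bornology.IsBounded Ω →
      ∀ F : EuclideanSpace ℝ (Fin n) → ℝ → EuclideanSpace ℝ (Fin n) →
          Matrix (Fin n) (Fin n) ℝ → ℝ,
        UniformlyElliptic lam Lam F → MonotoneInZ F →
        NaturalStructureCondition mu beta F →
      ∀ u : EuclideanSpace ℝ (Fin n) → ℝ, IsViscositySolution Ω F u →
      ∀ Q : Set (EuclideanSpace ℝ (Fin n) × EuclideanSpace ℝ (Fin n)),
        IsOpen Q → Bornology.IsBounded Q → Q ⊆ Ω ×ˢ Ω →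
      ∀ Φ : EuclideanSpace ℝ (Fin n) × EuclideanSpace ℝ (Fin n) → ℝ,
        ContDiffOn ℝ 2 Φ Q → (∀ p ∈ Q, 0 ≤ Φ p) →
      ∀ pm ∈ Q,
        0 < u pm.1 - u pm.2 - Φ pm →
        (∀ p ∈ Q, u p.1 - u p.2 - Φ p ≤ u pm.1 - u pm.2 - Φ pm) →
        -(lam / 2 - 2 * C₁ * omegaConst C₂ Lam beta Q Φ pm) *
            (UpsMat pm * Z2mat Q Φ pm).trace ≤
          C * (opNorm (Z1mat Q Φ pm) +
            (1 + Aconst Q Φ pm ^ 2 + opNorm (Zmat Q Φ pm)) *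
              omegaConst C₂ Lam beta Q Φ pm +
            opNorm (Z2mat Q Φ pm) * omegaConst C₂ Lam beta Q Φ pm ^ 2) := by
  have hLam : 0 < Lam := hlam.trans_le hlamLam
  refine ⟨1, mu * (2 * (1 + Lam)) ^ beta, 2 * (Lam * n + lam) + lam + 6 + 9 / lam, one_pos,
    by positivity, by positivity, ?_⟩
  rintro Ω - - F hF - hS u hu Q hQ - hQΩ Φ hΦ hΦ0 ⟨x₀, y₀⟩ hpm hpos hmax
  have hxy : x₀ ≠ y₀ := by
    rintro rfl
    have := hΦ0 _ hpm
    simp only at hpos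
    linarith
  have hd : 0 < ‖x₀ - y₀‖ := norm_pos_iff.2 (sub_ne_zero.2 hxy)
  set M := fderiv ℝ (fderiv ℝ Φ) (x₀, y₀) with hM
  set z₁ := opNorm (Z1mat Q Φ (x₀, y₀)) with hz₁
  set z₂ := opNorm (Z2mat Q Φ (x₀, y₀)) with hz₂
  set z := opNorm (Zmat Q Φ (x₀, y₀)) with hz
  set Z₀ := Z0vec Q Φ (x₀, y₀) with hZ₀
  set W := Wvec Q Φ (x₀, y₀) with hW
  set A := Aconst Q Φ (x₀, y₀) with hA
  have hAZW : A = ‖Z₀‖ + ‖W‖ := rfl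
  have hA0 : 0 ≤ A := add_nonneg (norm_nonneg _) (norm_nonneg _)
  set ω := omegaConst (mu * (2 * (1 + Lam)) ^ beta) Lam beta Q Φ (x₀, y₀) with hω
  have hωdef : ω = mu * (2 * (1 + Lam)) ^ beta *
    ((1 + A) * ‖x₀ - y₀‖ + ‖Z₀‖ / (1 + Lam)) ^ beta := rfl
  have hω0 : 0 < ω := by rw [hωdef]; positivity
  set e := ‖x₀ - y₀‖⁻¹ • (x₀ - y₀) with he
  have he1 : ‖e‖ = 1 := by rw [he, norm_smul, norm_inv, norm_norm, inv_mul_cancel₀ hd.ne']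
  have htr : (UpsMat (x₀, y₀) * Z2mat Q Φ (x₀, y₀)).trace = M (e, -e) (e, -e) := by
    rw [Z2mat_eq_bilinMat hQ hpm, trace_UpsMat_mul_bilinMat]
    rfl
  have hb₁ : ∀ a, M (a, a) (a, a) ≤ z₁ * ‖a‖ ^ 2 := fun a => by
    have := (le_abs_self _).trans (abs_bilin_le (B := M.bilinearComp
      ((ContinuousLinearMap.id ℝ _).prod (.id ℝ _))
      ((ContinuousLinearMap.id ℝ _).prod (.id ℝ _))) a a)
    rw [← Z1mat_eq_bilinMat hQ hpm, mul_assoc, ← pow_two] at this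
    exact this
  have hb₂ : ∀ a, ‖a‖ = 1 → |M (a, -a) (a, -a)| ≤ z₂ := fun a ha => by
    have := abs_bilin_le (B := M.bilinearComp
      ((ContinuousLinearMap.id ℝ _).prod (-.id ℝ _))
      ((ContinuousLinearMap.id ℝ _).prod (-.id ℝ _))) a a
    rw [← Z2mat_eq_bilinMat hQ hpm, ha, mul_one, mul_one] at this
    exact this
  have hb : ∀ a b, ‖a‖ = 1 → ‖b‖ = 1 → M (a, -a) (b, b) ≤ z := fun a b ha hb => by
    have := (le_abs_self _).trans (abs_bilin_le (B := M.bilinearComp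
      ((ContinuousLinearMap.id ℝ _).prod (-.id ℝ _))
      ((ContinuousLinearMap.id ℝ _).prod (.id ℝ _))) a b)
    rw [← Zmat_eq_bilinMat hQ hpm, ha, hb, mul_one, mul_one] at this
    exact this
  rw [htr]
  refine absorb_error_terms hlam (by positivity) hω0 (opNorm_nonneg _) (opNorm_nonneg _)
    (opNorm_nonneg _) (hb₂ e he1) fun hωlam => ?_
  have hD : ∀ a b, fderiv ℝ Φ (x₀, y₀) (a, b) =
      ⟪(1 / 2 : ℝ) • (Z₀ + W), a⟫ - ⟪(1 / 2 : ℝ) • (W - Z₀), b⟫ := fun a b => by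
    have h1 : ((a, b) : EuclideanSpace ℝ (Fin n) × EuclideanSpace ℝ (Fin n)) =
        (1 / 2 : ℝ) • (a + b, a + b) + (1 / 2 : ℝ) • (a - b, -(a - b)) := by
      ext1 <;> simp only [Prod.fst_add, Prod.snd_add, Prod.smul_mk] <;> module
    rw [h1, map_add, map_smul, map_smul, ← inner_Z0vec hQ hpm, ← inner_Wvec hQ hpm]
    simp only [inner_add_left, inner_sub_left, inner_add_right, inner_sub_right,
      real_inner_smul_left, smul_eq_mul]
    ring
  obtain ⟨ε, hε0, hε1, hεd, hεω⟩ : ∃ ε : ℝ, 0 < ε ∧ ε ≤ 1 / 8 ∧ ε ≤ ‖x₀ - y₀‖ / 8 ∧ ε ≤ ω :=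
    ⟨min (1 / 8) (min (‖x₀ - y₀‖ / 8) ω), lt_min (by norm_num) (lt_min (by linarith) hω0),
      min_le_left _ _,
      (min_le_right _ _).trans (min_le_left _ _), (min_le_right _ _).trans (min_le_right _ _)⟩
  obtain ⟨x, y, p, q, X, Y, hx, hy, hxε, hyε, hpε, hqε, hX, hY, hjx, hjy, hXY⟩ :=
    exists_jets_of_isMax (continuousOn_iff_lower_upperSemicontinuousOn.2 ⟨hu.2.1, hu.1.1⟩)
      hQ hQΩ hΦ hpm hmax hD hε0
  have hMs : ∀ a b, M a b = M b a := fun a b =>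
    (hΦ.contDiffAt (hQ.mem_nhds hpm)).isSymmSndFDerivAt (by simp) a b
  have hp : ‖p‖ ≤ A / 2 + ε := by
    have h1 := norm_add_le (p - (1 / 2 : ℝ) • (Z₀ + W)) ((1 / 2 : ℝ) • (Z₀ + W))
    have h2 := norm_add_le Z₀ W
    rw [sub_add_cancel, norm_smul, Real.norm_of_nonneg (by norm_num)] at h1
    linarith
  have hq : ‖q‖ ≤ A / 2 + ε := by
    have h1 := norm_add_le (q - (1 / 2 : ℝ) • (W - Z₀)) ((1 / 2 : ℝ) • (W - Z₀))
    have h2 := norm_sub_le W Z₀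
    rw [sub_add_cancel, norm_smul, Real.norm_of_nonneg (by norm_num)] at h1
    linarith
  have hyx : ‖y - x‖ ≤ ‖x₀ - y₀‖ + 2 * ε := by
    have h1 := norm_add₃_le (a := y - y₀) (b := y₀ - x₀) (c := x₀ - x)
    rw [show y - y₀ + (y₀ - x₀) + (x₀ - x) = y - x by abel, norm_sub_rev y₀,
      norm_sub_rev x₀ x] at h1
    linarith
  have hqp : ‖q - p‖ ≤ ‖Z₀‖ + 2 * ε := by
    have h1 := norm_add₃_le (a := q - (1 / 2 : ℝ) • (W - Z₀)) (b := -Z₀)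
      (c := (1 / 2 : ℝ) • (Z₀ + W) - p)
    rw [show q - (1 / 2 : ℝ) • (W - Z₀) + -Z₀ + ((1 / 2 : ℝ) • (Z₀ + W) - p) = q - p by module,
      norm_neg, norm_sub_rev ((1 / 2 : ℝ) • (Z₀ + W)) p] at h1
    linarith
  have hstr : F y (u y) q (bilinMat X) - F x (u x) p (bilinMat X) ≤
      ω * (A ^ 2 + 5 + opNorm (bilinMat X)) := by
    refine (le_abs_self _).trans ((hS y x (u y) (u x) q p _ (bilinMat_isSymm hX)).trans ?_)
    have hmod := structure_modulus_le (d' := ‖y - x‖) (P := ‖q‖) (R := ‖p‖) (r := ‖q - p‖)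
      hmu.le hbeta.le hLam.le hA0 hd.le (norm_nonneg Z₀) (norm_nonneg _) (norm_nonneg _)
      (norm_nonneg _) (norm_nonneg _) hε1 hεd hyx (by linarith) hqp
    refine mul_le_mul hmod ?_ (add_nonneg (by positivity) (opNorm_nonneg _)) hω0.le
    exact structure_factor_le (norm_nonneg p) (norm_nonneg q) hε1 hp hq
  exact elliptic_block_estimate hlam hLam.le hF hX hY hMs hXY hb₁ hb
    (fun a ha => (le_abs_self _).trans (hb₂ a ha)) (opNorm_nonneg _)
    (opNorm_nonneg _) (opNorm_nonneg _) hε0 hω0 hωlam hεω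
    (hu.1.le_zero_of_superjet hx hX hjx)
    (hu.2.zero_le_of_subjet hy (fun a b => by simp [hY a b]) hjy) hstr he1
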